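/- arXiv:1502.01750 — 2 statements merged into one kernel-verified Lean document; each statement's English description precedes it below -/
import Mathlib

section
/- Let q ∈ (0,1) and define C(θ) by the double integral C(θ) = (2/c₂) ∫₀^π (π^q λ^{−q} − 1) sin λ ∫₀^π (π^q a(θ,λ,φ)^{−q} − 1) dφ dλ, where a(θ,λ,φ) = arccos(sin θ sin λ cos φ + cos θ cos λ) and c₂ = 2π ∫₀^π (π^q λ^{−q} − 1)² sin λ dλ. Then lim_{θ↓0} (C(0) − C(θ))/θ^{2−2q} = b_q, where b_q = (2π^{2q}/c₂) ∫₀^∞ x^{1−q} ∫₀^π (x^{−q} − (x² + 1 − 2x cos φ)^{−q/2}) dφ dx. -/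
open Real Set Filter MeasureTheory

/-- The distance on the unit sphere between points at colatitudes `θ` and `l` whose longitudes
differ by `φ`. -/
noncomputable def sphDist (θ l φ : ℝ) : ℝ :=
  Real.arccos (Real.sin θ * Real.sin l * Real.cos φ + Real.cos θ * Real.cos l)

/-- The deviation of `l ^ (-q)` from `sphDist θ l φ ^ (-q)`, integrated over longitudes. -/
noncomputable def kernelGap (q θ l : ℝ) : ℝ :=
  ∫ φ in (0:ℝ)..π, (l ^ (-q) - sphDist θ l φ ^ (-q))

lemma continuous_sphDist (θ l : ℝ) : Continuous (sphDist θ l) := by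
  unfold sphDist; fun_prop

lemma cos_sphDist_arg_le {θ l : ℝ} (φ : ℝ) (hs : 0 ≤ Real.sin θ * Real.sin l) :
    Real.cos (l + θ) ≤ Real.sin θ * Real.sin l * Real.cos φ + Real.cos θ * Real.cos l ∧
    Real.sin θ * Real.sin l * Real.cos φ + Real.cos θ * Real.cos l ≤ Real.cos (l - θ) := by
  rw [Real.cos_add, Real.cos_sub]
  have h1 := Real.cos_le_one φ
  have h2 := Real.neg_one_le_cos φ
  constructor <;> nlinarith

lemma cos_sphDist {θ l : ℝ} (φ : ℝ) (hs : 0 ≤ Real.sin θ * Real.sin l) :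
    Real.cos (sphDist θ l φ) =
      Real.sin θ * Real.sin l * Real.cos φ + Real.cos θ * Real.cos l := by
  obtain ⟨h1, h2⟩ := cos_sphDist_arg_le φ hs
  exact Real.cos_arccos ((Real.neg_one_le_cos _).trans h1) (h2.trans (Real.cos_le_one _))

lemma abs_sub_le_sphDist {θ l : ℝ} (φ : ℝ) (hθ : θ ∈ Icc 0 π) (hl : l ∈ Icc 0 π) :
    |l - θ| ≤ sphDist θ l φ := by
  have hs := mul_nonneg (Real.sin_nonneg_of_mem_Icc hθ) (Real.sin_nonneg_of_mem_Icc hl)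
  have h2 := (cos_sphDist_arg_le φ hs).2
  rw [← Real.cos_abs (l - θ)] at h2
  have h3 : |l - θ| ≤ π := by
    rw [abs_le]; constructor <;> linarith [hθ.1, hθ.2, hl.1, hl.2]
  rw [← Real.arccos_cos (abs_nonneg _) h3]
  exact Real.arccos_le_arccos h2

lemma sphDist_le_add {θ l : ℝ} (φ : ℝ) (hθ : θ ∈ Icc 0 π) (hl : l ∈ Icc 0 π) :
    sphDist θ l φ ≤ l + θ := by
  have hs := mul_nonneg (Real.sin_nonneg_of_mem_Icc hθ) (Real.sin_nonneg_of_mem_Icc hl)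
  rcases le_total (l + θ) π with h | h
  · rw [← Real.arccos_cos (add_nonneg hl.1 hθ.1) h]
    exact Real.arccos_le_arccos (cos_sphDist_arg_le φ hs).1
  · exact (Real.arccos_le_pi _).trans h

lemma abs_sphDist_sub_le {θ l : ℝ} (φ : ℝ) (hθ : θ ∈ Icc 0 π) (hl : l ∈ Icc 0 π) :
    |sphDist θ l φ - l| ≤ θ := by
  have h1 := (le_abs_self _).trans (abs_sub_le_sphDist φ hθ hl)
  have h2 := sphDist_le_add φ hθ hl
  rw [abs_le]; constructor <;> linarith

lemma continuous_sphDist_rpow {θ l : ℝ} (q : ℝ) (hθ : θ ∈ Icc 0 π) (hl : l ∈ Icc 0 π)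
    (hne : l ≠ θ) : Continuous fun φ => sphDist θ l φ ^ (-q) := by
  refine (continuous_sphDist θ l).rpow_const fun φ => Or.inl ?_
  exact ((abs_pos.2 (sub_ne_zero.2 hne)).trans_le (abs_sub_le_sphDist φ hθ hl)).ne'

lemma abs_rpow_neg_sub_sphDist_le {q θ l : ℝ} (hq : 0 ≤ q) (φ : ℝ) (hθ : θ ∈ Icc 0 π)
    (hl : l ∈ Icc 0 π) (hne : l ≠ θ) :
    |l ^ (-q) - sphDist θ l φ ^ (-q)| ≤ l ^ (-q) + |l - θ| ^ (-q) := by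
  have h0 := abs_pos.2 (sub_ne_zero.2 hne)
  have h1 := abs_sub_le_sphDist φ hθ hl
  have h2 := Real.rpow_le_rpow_of_nonpos h0 h1 (neg_nonpos.2 hq)
  have h3 := Real.rpow_nonneg (h0.le.trans h1) (-q)
  have h4 := Real.rpow_nonneg hl.1 (-q)
  rw [abs_le]; constructor <;> linarith

lemma abs_kernelGap_le {q θ l : ℝ} (hq : 0 ≤ q) (hθ : θ ∈ Icc 0 π)
    (hl : l ∈ Icc 0 π) (hne : l ≠ θ) :
    |kernelGap q θ l| ≤ (l ^ (-q) + |l - θ| ^ (-q)) * π := by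
  have := intervalIntegral.norm_integral_le_of_norm_le_const (a := 0) (b := π)
    (f := fun φ => l ^ (-q) - sphDist θ l φ ^ (-q)) (C := l ^ (-q) + |l - θ| ^ (-q))
    fun φ _ => abs_rpow_neg_sub_sphDist_le hq φ hθ hl hne
  simpa [kernelGap, abs_of_pos Real.pi_pos] using this

lemma abs_rpow_neg_sub_linear_le {q s : ℝ} (hq0 : 0 ≤ q) (hq1 : q ≤ 1) (hs : 1 / 2 ≤ s) :
    |s ^ (-q) - 1 + q * (s - 1)| ≤ 2 * (s - 1) ^ 2 := by
  have hs0 : 0 < s := by linarith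
  have h1 : s ^ (-q) = (1 + (s⁻¹ - 1)) ^ q := by
    rw [Real.rpow_neg hs0.le, ← Real.inv_rpow hs0.le]; ring_nf
  have h2 : (1 + (s⁻¹ - 1)) ^ q ≤ 1 + q * (s⁻¹ - 1) :=
    rpow_one_add_le_one_add_mul_self (by linarith [inv_pos.2 hs0]) hq0 hq1
  have h3 : s ^ q ≤ 1 + q * (s - 1) := by
    have := rpow_one_add_le_one_add_mul_self (s := s - 1) (by linarith) hq0 hq1
    simpa using this
  have h4 : 1 ≤ s ^ (-q) * (1 + q * (s - 1)) := by
    have h5 := mul_le_mul_of_nonneg_left h3 (Real.rpow_nonneg hs0.le (-q))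
    rwa [← Real.rpow_add hs0, neg_add_cancel, Real.rpow_zero] at h5
  have h6 : s⁻¹ - 1 + (s - 1) ≤ 2 * (s - 1) ^ 2 := by
    have : s⁻¹ - 1 + (s - 1) = s⁻¹ * (s - 1) ^ 2 := by field_simp; ring
    rw [this]
    have : s⁻¹ ≤ 2 := by rw [inv_le_comm₀ hs0 (by norm_num)]; linarith
    gcongr
  have h7 : 0 ≤ s⁻¹ - 1 + (s - 1) := by
    have : s⁻¹ - 1 + (s - 1) = s⁻¹ * (s - 1) ^ 2 := by field_simp; ring
    rw [this]; positivity
  have h8 : 0 < s ^ (-q) := Real.rpow_pos_of_pos hs0 _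
  rw [abs_le]
  constructor
  · have h9 : 1 - q * (s - 1) ≤ s ^ (-q) := by
      by_contra! h
      have h10 : 0 < 1 + q * (s - 1) := by nlinarith
      nlinarith [sq_nonneg (q * (s - 1))]
    nlinarith [sq_nonneg (s - 1)]
  · nlinarith

lemma abs_cos_add_linear_le {l d : ℝ} (hd : |d| ≤ 1) :
    |Real.cos (l + d) - Real.cos l + Real.sin l * d| ≤ d ^ 2 := by
  have h1 := Real.one_sub_sq_div_two_le_cos (x := d)
  have h2 := Real.cos_le_one d
  have h3 := Real.sin_bound hd
  have e : Real.cos (l + d) - Real.cos l + Real.sin l * d =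
      Real.cos l * (Real.cos d - 1) + Real.sin l * (d - Real.sin d) := by
    rw [Real.cos_add]; ring
  have h4 : |d - Real.sin d| ≤ d ^ 2 / 2 := by
    have e2 : d - Real.sin d = -(Real.sin d - (d - d ^ 3 / 6)) + d ^ 3 / 6 := by ring
    have h5 : |d| ^ 5 ≤ d ^ 2 := by
      rw [← sq_abs d]; exact pow_le_pow_of_le_one (abs_nonneg d) hd (by norm_num)
    have h6 : |d ^ 3 / 6| ≤ d ^ 2 / 6 := by
      rw [abs_div, abs_pow, ← sq_abs d, abs_of_pos (by norm_num : (0:ℝ) < 6)]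
      nlinarith [sq_nonneg |d|]
    rw [e2]
    refine (abs_add_le _ _).trans ?_
    rw [abs_neg]
    nlinarith [sq_nonneg d]
  rw [e]
  refine (abs_add_le _ _).trans ?_
  rw [abs_mul, abs_mul]
  have h7 : |Real.cos d - 1| ≤ d ^ 2 / 2 := by
    rw [abs_le]; constructor <;> nlinarith [sq_nonneg d]
  have := mul_le_mul (Real.abs_cos_le_one l) h7 (abs_nonneg _) zero_le_one
  have := mul_le_mul (Real.abs_sin_le_one l) h4 (abs_nonneg _) zero_le_one
  linarith

lemma abs_sin_mul_kernelGap_le {q θ l : ℝ} (hq0 : 0 ≤ q) (hq1 : q ≤ 1) (hθ : 0 < θ)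
    (hθ1 : θ ≤ 1) (hl : 2 * θ ≤ l) (hlπ : l ≤ π) :
    |Real.sin l * kernelGap q θ l| ≤ 4 * π * (θ ^ 2 * l ^ (-q - 1)) := by
  have hl0 : 0 < l := by linarith
  have hθm : θ ∈ Icc 0 π := ⟨hθ.le, by linarith [Real.pi_gt_three]⟩
  have hlm : l ∈ Icc 0 π := ⟨hl0.le, hlπ⟩
  have hs0 := Real.sin_nonneg_of_mem_Icc hlm
  have hs := mul_nonneg (Real.sin_nonneg_of_mem_Icc hθm) hs0
  have hsl : Real.sin l ≤ l := Real.sin_le hl0.le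
  set K := l ^ (-q - 1) with hK
  have hK0 : 0 < K := Real.rpow_pos_of_pos hl0 _
  have hKl : l ^ (-q) = K * l := by
    rw [hK, ← Real.rpow_add_one hl0.ne']; ring_nf
  have key : ∀ φ, |Real.sin l * (l ^ (-q) - sphDist θ l φ ^ (-q)) -
      q * K * (Real.cos l - Real.cos (sphDist θ l φ))| ≤ 3 * (θ ^ 2 * K) := by
    intro φ
    obtain ⟨d, hd⟩ : ∃ d, d = sphDist θ l φ - l := ⟨_, rfl⟩
    have hdθ : |d| ≤ θ := hd ▸ abs_sphDist_sub_le φ hθm hlm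
    have ha : sphDist θ l φ = l + d := by rw [hd]; ring
    have hd2 : d ^ 2 ≤ θ ^ 2 := by rw [← sq_abs d]; gcongr
    have hdl := abs_le.1 hdθ
    have hsph : sphDist θ l φ ^ (-q) = l ^ (-q) * (1 + d / l) ^ (-q) := by
      have h1 : 0 ≤ 1 + d / l := by
        have : 1 + d / l = (l + d) / l := by field_simp
        rw [this]; exact div_nonneg (by linarith) hl0.le
      rw [← Real.mul_rpow hl0.le h1, ha]; congr 1; field_simp
    have hR := abs_rpow_neg_sub_linear_le (s := 1 + d / l) hq0 hq1 (by
      have : 1 + d / l = (l + d) / l := by field_simp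
      rw [this, le_div_iff₀ hl0]; linarith)
    have hE := abs_cos_add_linear_le (l := l) (hdθ.trans hθ1)
    set R := (1 + d / l) ^ (-q) - 1 + q * (1 + d / l - 1) with hRdef
    set E := Real.cos (l + d) - Real.cos l + Real.sin l * d with hEdef
    have e : Real.sin l * (l ^ (-q) - sphDist θ l φ ^ (-q)) -
        q * K * (Real.cos l - Real.cos (sphDist θ l φ)) =
        q * K * E - K * l * Real.sin l * R := by
      have : (1 + d / l) ^ (-q) = R + 1 - q * (d / l) := by rw [hRdef]; ring
      rw [hsph, ha, this, hKl, hEdef]; field_simp; ring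
    rw [e]
    have h1 : |q * K * E| ≤ θ ^ 2 * K := by
      rw [abs_mul, abs_of_nonneg (mul_nonneg hq0 hK0.le)]
      calc q * K * |E| ≤ 1 * K * θ ^ 2 := by gcongr; exact hE.trans hd2
        _ = _ := by ring
    have h2 : |K * l * Real.sin l * R| ≤ 2 * (θ ^ 2 * K) := by
      rw [abs_mul, abs_of_nonneg (by positivity)]
      calc K * l * Real.sin l * |R| ≤ K * l * l * (2 * (1 + d / l - 1) ^ 2) := by gcongr
        _ = 2 * (d ^ 2 * K) := by field_simp; ring
        _ ≤ _ := by gcongr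
    linarith [abs_sub (q * K * E) (K * l * Real.sin l * R)]
  have hc1 : Continuous fun φ => Real.sin l * (l ^ (-q) - sphDist θ l φ ^ (-q)) :=
    continuous_const.mul (continuous_const.sub
      (continuous_sphDist_rpow q hθm hlm (by linarith)))
  have hc2 : Continuous fun φ => q * K * (Real.cos l - Real.cos (sphDist θ l φ)) :=
    continuous_const.mul (continuous_const.sub
      (Real.continuous_cos.comp (continuous_sphDist θ l)))
  have h1 := intervalIntegral.norm_integral_le_of_norm_le_const (a := 0) (b := π)
    fun φ _ => (Real.norm_eq_abs _).trans_le (key φ)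
  rw [intervalIntegral.integral_sub (hc1.intervalIntegrable _ _) (hc2.intervalIntegrable _ _),
    intervalIntegral.integral_const_mul] at h1
  have h2 : ∫ φ in (0:ℝ)..π, q * K * (Real.cos l - Real.cos (sphDist θ l φ)) =
      q * K * (π * Real.cos l * (1 - Real.cos θ)) := by
    rw [intervalIntegral.integral_const_mul]
    congr 1
    have : ∀ φ, Real.cos l - Real.cos (sphDist θ l φ) =
      Real.cos l * (1 - Real.cos θ) - Real.sin θ * Real.sin l * Real.cos φ := by
      intro φ; rw [cos_sphDist φ hs]; ring
    simp_rw [this]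
    rw [intervalIntegral.integral_sub (by simp) (Continuous.intervalIntegrable (by fun_prop) _ _),
      intervalIntegral.integral_const_mul, intervalIntegral.integral_const_mul, integral_cos]
    simp; ring
  have h3 : |q * K * (π * Real.cos l * (1 - Real.cos θ))| ≤ θ ^ 2 * K * π := by
    have h4 : |1 - Real.cos θ| ≤ θ ^ 2 := by
      rw [abs_of_nonneg (by linarith [Real.cos_le_one θ])]
      nlinarith [Real.one_sub_sq_div_two_le_cos (x := θ), sq_nonneg θ]
    rw [abs_mul, abs_of_nonneg (mul_nonneg hq0 hK0.le), abs_mul, abs_mul, abs_of_pos Real.pi_pos]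
    calc q * K * (π * |Real.cos l| * |1 - Real.cos θ|) ≤ 1 * K * (π * 1 * θ ^ 2) := by
          gcongr; exact Real.abs_cos_le_one l
      _ = _ := by ring
  rw [h2, Real.norm_eq_abs, sub_zero, abs_of_pos Real.pi_pos] at h1
  change |Real.sin l * kernelGap q θ l - _| ≤ _ at h1
  have := abs_sub_abs_le_abs_sub (Real.sin l * kernelGap q θ l)
    (q * K * (π * Real.cos l * (1 - Real.cos θ)))
  linarith

lemma mul_sinc_self (t : ℝ) : t * Real.sinc t = Real.sin t := by
  rcases eq_or_ne t 0 with rfl | h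
  · simp
  · rw [Real.sinc_of_ne_zero h]; field_simp

lemma sq_mul_sinc_half_sq (t : ℝ) : t ^ 2 * Real.sinc (t / 2) ^ 2 = 2 * (1 - Real.cos t) := by
  have h1 := mul_sinc_self (t / 2)
  have h2 := Real.sin_sq_eq_half_sub (t / 2)
  rw [mul_div_cancel₀ t two_ne_zero] at h2
  linear_combination 4 * (t / 2 * Real.sinc (t / 2) + Real.sin (t / 2)) * h1 + 4 * h2

lemma eventually_mem_Icc_zero_pi :
    ∀ᶠ θ : ℝ in nhdsWithin 0 (Ioi 0), θ ∈ Icc 0 π :=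
  mem_of_superset (Ioc_mem_nhdsGT Real.pi_pos) Ioc_subset_Icc_self

lemma eventually_mul_mem_Ioc_zero_pi {x : ℝ} (hx : 0 < x) :
    ∀ᶠ θ : ℝ in nhdsWithin 0 (Ioi 0), θ * x ∈ Ioc 0 π := by
  filter_upwards [Ioc_mem_nhdsGT (div_pos Real.pi_pos hx)] with θ hθ
  exact ⟨mul_pos hθ.1 hx, (le_div_iff₀ hx).1 hθ.2⟩

lemma tendsto_sphDist_mul (x φ : ℝ) :
    Tendsto (fun θ => sphDist θ (θ * x) φ) (nhdsWithin 0 (Ioi 0)) (nhds 0) := by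
  have h : Continuous fun θ => sphDist θ (θ * x) φ := by unfold sphDist; fun_prop
  have h0 := h.tendsto 0
  simp only [sphDist, Real.sin_zero, Real.cos_zero, zero_mul, mul_one, zero_add,
    Real.arccos_one] at h0
  exact h0.mono_left nhdsWithin_le_nhds

lemma sub_one_sq_le {x : ℝ} (φ : ℝ) (hx : 0 ≤ x) :
    (x - 1) ^ 2 ≤ x ^ 2 + 1 - 2 * x * Real.cos φ := by
  nlinarith [Real.cos_le_one φ]

lemma tendsto_sphDist_div_rpow {q x : ℝ} (hx : 0 < x) (hx1 : x ≠ 1) (φ : ℝ) :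
    Tendsto (fun θ => (sphDist θ (θ * x) φ / θ) ^ (-q)) (nhdsWithin 0 (Ioi 0))
      (nhds ((x ^ 2 + 1 - 2 * x * Real.cos φ) ^ (-q / 2))) := by
  have hP : 0 < x ^ 2 + 1 - 2 * x * Real.cos φ :=
    (pow_pos (abs_pos.2 (sub_ne_zero.2 hx1)) 2).trans_le
      ((sq_abs (x - 1)).trans_le (sub_one_sq_le φ hx.le))
  have hs : Tendsto (fun θ => Real.sinc (sphDist θ (θ * x) φ / 2) ^ 2)
      (nhdsWithin 0 (Ioi 0)) (nhds 1) := by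
    have h := (Real.continuous_sinc.tendsto (0 / 2)).comp ((tendsto_sphDist_mul x φ).div_const 2)
    simpa using h.pow 2
  have hN : Tendsto (fun θ => Real.sinc (θ / 2) ^ 2
      + Real.cos θ * (x ^ 2 * Real.sinc (θ * x / 2) ^ 2)
      - 2 * (Real.sinc θ * (x * Real.sinc (θ * x)) * Real.cos φ)) (nhdsWithin 0 (Ioi 0))
      (nhds (x ^ 2 + 1 - 2 * x * Real.cos φ)) := by
    have h : Continuous fun θ => Real.sinc (θ / 2) ^ 2
      + Real.cos θ * (x ^ 2 * Real.sinc (θ * x / 2) ^ 2)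
      - 2 * (Real.sinc θ * (x * Real.sinc (θ * x)) * Real.cos φ) := by
      have := Real.continuous_sinc
      fun_prop
    have h0 := h.tendsto 0
    simp only [zero_div, zero_mul, Real.sinc_zero, Real.cos_zero] at h0
    convert h0.mono_left nhdsWithin_le_nhds using 2
    ring
  have hsq : Tendsto (fun θ => (sphDist θ (θ * x) φ / θ) ^ 2) (nhdsWithin 0 (Ioi 0))
      (nhds (x ^ 2 + 1 - 2 * x * Real.cos φ)) := by
    have h := hN.div hs one_ne_zero
    rw [div_one] at h
    refine h.congr' ?_
    filter_upwards [eventually_mem_Icc_zero_pi, eventually_mul_mem_Ioc_zero_pi hx,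
      self_mem_nhdsWithin, hs.eventually_ne one_ne_zero] with θ hθ hl hθ0 hne
    have hθ0 : θ ≠ 0 := ne_of_gt hθ0
    have hl' := Ioc_subset_Icc_self hl
    have h1 := sq_mul_sinc_half_sq (sphDist θ (θ * x) φ)
    rw [cos_sphDist φ (mul_nonneg (Real.sin_nonneg_of_mem_Icc hθ)
      (Real.sin_nonneg_of_mem_Icc hl'))] at h1
    have h2 := sq_mul_sinc_half_sq θ
    have h3 := sq_mul_sinc_half_sq (θ * x)
    have h4 := mul_sinc_self θ
    have h5 := mul_sinc_self (θ * x)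
    simp only [Pi.div_apply]
    rw [div_eq_iff hne, div_pow, div_mul_eq_mul_div, h1, eq_div_iff (pow_ne_zero 2 hθ0)]
    rw [← h4, ← h5]
    linear_combination h2 + Real.cos θ * h3
  have h := hsq.rpow_const (p := -q / 2) (Or.inl hP.ne')
  refine h.congr' ?_
  filter_upwards [self_mem_nhdsWithin] with θ hθ
  have h0 : 0 ≤ sphDist θ (θ * x) φ / θ := div_nonneg (Real.arccos_nonneg _) (le_of_lt hθ)
  rw [← Real.rpow_natCast, ← Real.rpow_mul h0]
  congr 1; push_cast; ring

lemma tendsto_rpow_mul_kernelGap {q x : ℝ} (hq : 0 ≤ q) (hx : 0 < x) (hx1 : x ≠ 1) :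
    Tendsto (fun θ => θ ^ q * kernelGap q θ (θ * x)) (nhdsWithin 0 (Ioi 0))
      (nhds (∫ φ in (0:ℝ)..π, (x ^ (-q) - (x ^ 2 + 1 - 2 * x * Real.cos φ) ^ (-q / 2)))) := by
  have hscale : ∀ θ > (0 : ℝ), ∀ y, 0 ≤ y → θ ^ q * y ^ (-q) = (y / θ) ^ (-q) := by
    intro θ hθ y hy
    rw [Real.div_rpow hy hθ.le, Real.rpow_neg hθ.le, div_inv_eq_mul, mul_comm]
  have hmain : Tendsto (fun θ => ∫ φ in (0:ℝ)..π,
      θ ^ q * ((θ * x) ^ (-q) - sphDist θ (θ * x) φ ^ (-q))) (nhdsWithin 0 (Ioi 0))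
      (nhds (∫ φ in (0:ℝ)..π, (x ^ (-q) - (x ^ 2 + 1 - 2 * x * Real.cos φ) ^ (-q / 2)))) := by
    refine intervalIntegral.tendsto_integral_filter_of_dominated_convergence
      (fun _ => x ^ (-q) + |x - 1| ^ (-q)) ?_ ?_ (by simp) ?_
    · filter_upwards [eventually_mem_Icc_zero_pi, eventually_mul_mem_Ioc_zero_pi hx,
        self_mem_nhdsWithin] with θ hθ hl hθ0
      have hne : θ * x ≠ θ := by
        intro h; exact hx1 (mul_left_cancel₀ (ne_of_gt hθ0) (h.trans (mul_one θ).symm))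
      exact (continuous_const.mul (continuous_const.sub (continuous_sphDist_rpow q hθ
        (Ioc_subset_Icc_self hl) hne))).aestronglyMeasurable
    · filter_upwards [eventually_mem_Icc_zero_pi, eventually_mul_mem_Ioc_zero_pi hx,
        self_mem_nhdsWithin] with θ hθ hl hθ0
      have hθ0 : 0 < θ := hθ0
      have hne : θ * x ≠ θ := by
        intro h; exact hx1 (mul_left_cancel₀ (ne_of_gt hθ0) (h.trans (mul_one θ).symm))
      refine Eventually.of_forall fun φ _ => ?_
      have h := abs_rpow_neg_sub_sphDist_le hq φ hθ (Ioc_subset_Icc_self hl) hne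
      have h1 := hscale θ hθ0 (θ * x) hl.1.le
      have h2 := hscale θ hθ0 |θ * x - θ| (abs_nonneg _)
      have e1 : θ * x / θ = x := by field_simp
      have e2 : |θ * x - θ| / θ = |x - 1| := by
        rw [show θ * x - θ = θ * (x - 1) by ring, abs_mul, abs_of_pos hθ0]; field_simp
      rw [e1] at h1; rw [e2] at h2
      rw [Real.norm_eq_abs, abs_mul, abs_of_pos (Real.rpow_pos_of_pos hθ0 q), ← h1, ← h2, ← mul_add]
      gcongr
    · refine Eventually.of_forall fun φ _ => ?_
      have h := (tendsto_sphDist_div_rpow (q := q) hx hx1 φ).const_sub (x ^ (-q))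
      refine h.congr' ?_
      filter_upwards [self_mem_nhdsWithin] with θ hθ
      have hθ : 0 < θ := hθ
      rw [mul_sub, hscale θ hθ (sphDist θ (θ * x) φ) (Real.arccos_nonneg _),
        hscale θ hθ _ (by positivity)]
      congr 2; field_simp
  refine hmain.congr fun θ => ?_
  rw [intervalIntegral.integral_const_mul, kernelGap]

/-- The integrand of `C 0 - C θ`, divided by `2 π ^ q / c₂`. -/
noncomputable def powerIntegrand (q θ l : ℝ) : ℝ :=
  (π ^ q * l ^ (-q) - 1) * Real.sin l * kernelGap q θ l

lemma measurable_powerIntegrand (q θ : ℝ) : Measurable (powerIntegrand q θ) := by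
  have h : Measurable (kernelGap q θ) := by
    have h1 : StronglyMeasurable
        (Function.uncurry fun l φ : ℝ => l ^ (-q) - sphDist θ l φ ^ (-q)) := by
      apply Measurable.stronglyMeasurable
      have h2 : Measurable fun p : ℝ × ℝ => sphDist θ p.1 p.2 := by
        unfold sphDist
        exact Continuous.measurable (by fun_prop)
      unfold Function.uncurry
      fun_prop
    have h3 := (h1.integral_prod_right (ν := volume.restrict (Ioc 0 π))).measurable
    have e : kernelGap q θ = fun l => ∫ φ in Ioc 0 π, (l ^ (-q) - sphDist θ l φ ^ (-q)) := by
      ext l; rw [kernelGap, intervalIntegral.integral_of_le Real.pi_pos.le]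
    rw [e]; exact h3
  unfold powerIntegrand
  fun_prop

lemma power_kernel_nonneg {q l : ℝ} (hq : 0 ≤ q) (hl : l ∈ Ioc 0 π) :
    0 ≤ π ^ q * l ^ (-q) - 1 := by
  rw [Real.rpow_neg hl.1.le, ← div_eq_mul_inv, sub_nonneg,
    one_le_div (Real.rpow_pos_of_pos hl.1 q)]
  exact Real.rpow_le_rpow hl.1.le hl.2 hq

lemma abs_power_kernel_le {q l : ℝ} (hq : 0 ≤ q) (hl : l ∈ Ioc 0 π) :
    |π ^ q * l ^ (-q) - 1| ≤ π ^ q * l ^ (-q) := by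
  rw [abs_of_nonneg (power_kernel_nonneg hq hl)]; linarith

/-- An integrable function dominating the rescaled integrand. -/
noncomputable def dominant (q x : ℝ) : ℝ :=
  4 * π * π ^ q * (if x ≤ 2 then x ^ (-q) * x * (x ^ (-q) + |x - 1| ^ (-q))
    else x ^ (-q) * x ^ (-q - 1))

lemma intervalIntegrable_abs_sub_one_rpow {r : ℝ} (hr : -1 < r) :
    IntervalIntegrable (fun x : ℝ => |x - 1| ^ r) volume 0 2 := by
  have h0 : IntervalIntegrable (fun x : ℝ => |x| ^ r) volume 0 1 := by
    refine (intervalIntegral.intervalIntegrable_rpow' hr).congr fun x hx => ?_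
    rw [uIoc_of_le zero_le_one] at hx
    simp only [abs_of_pos hx.1]
  have h1 : IntervalIntegrable (fun x : ℝ => |x| ^ r) volume (-1) 0 := by
    have h := ((IntervalIntegrable.iff_comp_neg (by simp)).1 h0).symm
    simpa using h
  have h2 := (h1.trans h0).comp_sub_right 1
  norm_num at h2
  exact h2

lemma integrableOn_dominant {q : ℝ} (hq : q ∈ Ioo (0:ℝ) 1) :
    IntegrableOn (dominant q) (Ioi 0) := by
  unfold dominant
  refine Integrable.const_mul ?_ _
  rw [← Ioc_union_Ioi_eq_Ioi (zero_le_two : (0:ℝ) ≤ 2)]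
  refine IntegrableOn.union ?_ ?_
  · have h1 : IntegrableOn (fun x : ℝ => x ^ (1 - 2 * q)) (Ioc 0 2) :=
      (intervalIntegrable_iff_integrableOn_Ioc_of_le zero_le_two).1
        (intervalIntegral.intervalIntegrable_rpow' (by linarith [hq.2]))
    have h2 : IntegrableOn (fun x : ℝ => x ^ (1 - q) * |x - 1| ^ (-q)) (Ioc 0 2) := by
      refine (intervalIntegrable_iff_integrableOn_Ioc_of_le zero_le_two).1 ?_
      refine (intervalIntegrable_abs_sub_one_rpow (by linarith [hq.2])).continuousOn_mul ?_
      exact (Real.continuous_rpow_const (by linarith [hq.2])).continuousOn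
    refine (h1.add h2).congr_fun (fun x hx => ?_) measurableSet_Ioc
    simp only [Pi.add_apply, if_pos hx.2]
    rw [show 1 - 2 * q = (-q + 1) + -q by ring, show 1 - q = -q + 1 by ring,
      Real.rpow_add hx.1, Real.rpow_add_one hx.1.ne']
    ring
  · have h1 : IntegrableOn (fun x : ℝ => x ^ (-q + (-q - 1))) (Ioi 2) :=
      integrableOn_Ioi_rpow_of_lt (by linarith [hq.1]) two_pos
    refine h1.congr_fun (fun x hx => ?_) measurableSet_Ioi
    have hx : 2 < x := hx
    simp only [if_neg (not_le.2 hx)]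
    rw [Real.rpow_add (by linarith)]

/-- `powerIntegrand` after the substitution `l = θ x`, normalised by `θ ^ (1 - 2 q)`. -/
noncomputable def scaledIntegrand (q θ x : ℝ) : ℝ :=
  θ ^ (2 * q - 1) * (Ioc 0 π).indicator (powerIntegrand q θ) (θ * x)

lemma abs_scaledIntegrand_le {q θ x : ℝ} (hq : q ∈ Ioo (0:ℝ) 1) (hθ : 0 < θ) (hθ1 : θ ≤ 1)
    (hx : 0 < x) (hx1 : x ≠ 1) : |scaledIntegrand q θ x| ≤ dominant q x := by
  have hπ := Real.pi_pos
  have hdom : 0 ≤ dominant q x := by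
    unfold dominant; split_ifs <;> positivity
  unfold scaledIntegrand
  by_cases hl : θ * x ∈ Ioc 0 π
  swap
  · simpa [indicator_of_notMem hl] using hdom
  rw [indicator_of_mem hl]
  have hk := abs_power_kernel_le hq.1.le hl
  have hlm := Ioc_subset_Icc_self hl
  have hθm : θ ∈ Icc 0 π := ⟨hθ.le, by linarith [Real.pi_gt_three]⟩
  have hs0 := Real.sin_nonneg_of_mem_Icc hlm
  have hne : θ * x ≠ θ := by
    intro h; exact hx1 (mul_left_cancel₀ hθ.ne' (h.trans (mul_one θ).symm))
  have hmul : ∀ r : ℝ, (θ * x) ^ r = θ ^ r * x ^ r := fun r => Real.mul_rpow hθ.le hx.le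
  have hθpow : θ ^ (2 * q - 1) * (θ ^ (-q) * θ * θ ^ (-q)) = 1 := by
    rw [← Real.rpow_add_one hθ.ne', ← Real.rpow_add hθ, ← Real.rpow_add hθ]
    ring_nf; simp
  unfold powerIntegrand dominant
  rw [abs_mul, abs_of_pos (Real.rpow_pos_of_pos hθ _)]
  split_ifs with h2
  · have hg := abs_kernelGap_le hq.1.le hθm hlm hne
    rw [abs_mul, abs_mul, abs_of_nonneg hs0]
    have e : |θ * x - θ| ^ (-q) = θ ^ (-q) * |x - 1| ^ (-q) := by
      rw [show θ * x - θ = θ * (x - 1) by ring, abs_mul, abs_of_pos hθ,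
        Real.mul_rpow hθ.le (abs_nonneg _)]
    calc _ ≤ θ ^ (2 * q - 1) * (π ^ q * (θ * x) ^ (-q) * (θ * x) *
          (((θ * x) ^ (-q) + |θ * x - θ| ^ (-q)) * π)) := by
          gcongr; exact Real.sin_le hl.1.le
      _ = (θ ^ (2 * q - 1) * (θ ^ (-q) * θ * θ ^ (-q))) *
          (1 * π * π ^ q * (x ^ (-q) * x * (x ^ (-q) + |x - 1| ^ (-q)))) := by
          rw [e, hmul]; ring
      _ = 1 * π * π ^ q * (x ^ (-q) * x * (x ^ (-q) + |x - 1| ^ (-q))) := by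
          rw [hθpow, one_mul]
      _ ≤ _ := by gcongr; norm_num
  · have hg := abs_sin_mul_kernelGap_le hq.1.le hq.2.le hθ hθ1 (l := θ * x)
      (by nlinarith) hl.2
    rw [mul_assoc (_ - 1), abs_mul]
    calc _ ≤ θ ^ (2 * q - 1) * (π ^ q * (θ * x) ^ (-q) *
          (4 * π * (θ ^ 2 * (θ * x) ^ (-q - 1)))) := by gcongr
      _ = (θ ^ (2 * q - 1) * (θ ^ (-q) * θ * θ ^ (-q))) *
          (4 * π * π ^ q * (x ^ (-q) * x ^ (-q - 1))) := by
          rw [hmul, hmul, show θ ^ (-q - 1) = θ ^ (-q) / θ from Real.rpow_sub_one hθ.ne' _]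
          field_simp
      _ = _ := by rw [hθpow, one_mul]

lemma tendsto_scaledIntegrand {q x : ℝ} (hq : q ∈ Ioo (0:ℝ) 1) (hx : 0 < x) (hx1 : x ≠ 1) :
    Tendsto (fun θ => scaledIntegrand q θ x) (nhdsWithin 0 (Ioi 0))
      (nhds (π ^ q * (x ^ (1 - q) *
        ∫ φ in (0:ℝ)..π, (x ^ (-q) - (x ^ 2 + 1 - 2 * x * Real.cos φ) ^ (-q / 2))))) := by
  have h1 := tendsto_rpow_mul_kernelGap hq.1.le hx hx1
  have h2 : Tendsto (fun θ : ℝ => x * Real.sinc (θ * x)) (nhdsWithin 0 (Ioi 0)) (nhds x) := by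
    have h : Continuous fun θ : ℝ => x * Real.sinc (θ * x) := by
      have := Real.continuous_sinc
      fun_prop
    have h0 := h.tendsto 0
    simp only [zero_mul, Real.sinc_zero, mul_one] at h0
    exact h0.mono_left nhdsWithin_le_nhds
  have h3 : Tendsto (fun θ : ℝ => π ^ q * x ^ (-q) - θ ^ q) (nhdsWithin 0 (Ioi 0))
      (nhds (π ^ q * x ^ (-q))) := by
    have h0 := ((Real.continuous_rpow_const hq.1.le).tendsto 0).const_sub (π ^ q * x ^ (-q))
    rw [Real.zero_rpow hq.1.ne', sub_zero] at h0
    exact h0.mono_left nhdsWithin_le_nhds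
  have h := (h3.mul h2).mul h1
  have e : π ^ q * x ^ (-q) * x = π ^ q * x ^ (1 - q) := by
    rw [mul_assoc, ← Real.rpow_add_one hx.ne']; ring_nf
  rw [e, mul_assoc] at h
  refine h.congr' ?_
  filter_upwards [eventually_mul_mem_Ioc_zero_pi hx, self_mem_nhdsWithin] with θ hl hθ
  have hθ : 0 < θ := hθ
  rw [scaledIntegrand, indicator_of_mem hl, powerIntegrand, ← mul_sinc_self (θ * x),
    Real.mul_rpow hθ.le hx.le, show 2 * q - 1 = q + q - 1 by ring, Real.rpow_sub_one hθ.ne',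
    Real.rpow_add hθ, Real.rpow_neg hθ.le]
  have := Real.rpow_pos_of_pos hθ q
  field_simp

lemma measurable_scaledIntegrand (q θ : ℝ) : Measurable (scaledIntegrand q θ) :=
  (((measurable_powerIntegrand q θ).indicator measurableSet_Ioc).comp
    (measurable_const_mul θ)).const_mul _

lemma ae_pos_ne_one : ∀ᵐ x : ℝ ∂volume.restrict (Ioi 0), 0 < x ∧ x ≠ 1 :=
  (ae_restrict_mem measurableSet_Ioi).and (ae_restrict_of_ae (Measure.ae_ne volume 1))

lemma tendsto_integral_scaledIntegrand {q : ℝ} (hq : q ∈ Ioo (0:ℝ) 1) :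
    Tendsto (fun θ => ∫ x in Ioi (0:ℝ), scaledIntegrand q θ x) (nhdsWithin 0 (Ioi 0))
      (nhds (π ^ q * ∫ x in Ioi (0:ℝ), x ^ (1 - q) *
        ∫ φ in (0:ℝ)..π, (x ^ (-q) - (x ^ 2 + 1 - 2 * x * Real.cos φ) ^ (-q / 2)))) := by
  rw [← integral_const_mul]
  refine tendsto_integral_filter_of_dominated_convergence (dominant q) ?_ ?_
    (integrableOn_dominant hq) ?_
  · exact Eventually.of_forall fun θ => (measurable_scaledIntegrand q θ).aestronglyMeasurable
  · filter_upwards [Ioc_mem_nhdsGT (zero_lt_one : (0:ℝ) < 1)] with θ hθ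
    filter_upwards [ae_pos_ne_one] with x hx
    exact abs_scaledIntegrand_le hq hθ.1 hθ.2 hx.1 hx.2
  · filter_upwards [ae_pos_ne_one] with x hx
    exact tendsto_scaledIntegrand hq hx.1 hx.2

lemma integrableOn_powerIntegrand {q θ : ℝ} (hq : q ∈ Ioo (0:ℝ) 1) (hθ : 0 < θ) (hθ1 : θ ≤ 1) :
    IntegrableOn (powerIntegrand q θ) (Ioc 0 π) := by
  have h : IntegrableOn (scaledIntegrand q θ) (Ioi 0) := by
    refine (integrableOn_dominant hq).mono'
      (measurable_scaledIntegrand q θ).aestronglyMeasurable ?_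
    filter_upwards [ae_pos_ne_one] with x hx
    exact abs_scaledIntegrand_le hq hθ hθ1 hx.1 hx.2
  have h1 : IntegrableOn (fun x => (Ioc 0 π).indicator (powerIntegrand q θ) (θ * x)) (Ioi 0) :=
    (integrable_const_mul_iff (IsUnit.mk0 _ (Real.rpow_pos_of_pos hθ (2 * q - 1)).ne') _).1 h
  rw [integrableOn_Ioi_comp_mul_left_iff _ _ hθ, mul_zero] at h1
  rw [IntegrableOn, integrable_indicator_iff measurableSet_Ioc, IntegrableOn,
    Measure.restrict_restrict measurableSet_Ioc,
    inter_eq_left.2 Ioc_subset_Ioi_self] at h1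
  exact h1

lemma integral_scaledIntegrand {q θ : ℝ} (hθ : 0 < θ) :
    ∫ x in Ioi (0:ℝ), scaledIntegrand q θ x =
      (∫ l in (0:ℝ)..π, powerIntegrand q θ l) / θ ^ (2 - 2 * q) := by
  unfold scaledIntegrand
  rw [integral_const_mul, integral_comp_mul_left_Ioi _ _ hθ, mul_zero,
    setIntegral_indicator measurableSet_Ioc, inter_eq_right.2 Ioc_subset_Ioi_self,
    intervalIntegral.integral_of_le Real.pi_pos.le, smul_eq_mul, ← mul_assoc,
    ← div_eq_mul_inv, ← Real.rpow_sub_one hθ.ne', show 2 * q - 1 - 1 = -(2 - 2 * q) by ring,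
    Real.rpow_neg hθ.le, inv_mul_eq_div]

/-- The integrand defining the correlation function at angle `θ`. -/
noncomputable def corrIntegrand (q θ l : ℝ) : ℝ :=
  (π ^ q * l ^ (-q) - 1) * Real.sin l *
    ∫ φ in (0:ℝ)..π, (π ^ q * sphDist θ l φ ^ (-q) - 1)

lemma corrIntegrand_zero {q l : ℝ} (hl : l ∈ Ioc 0 π) :
    corrIntegrand q 0 l = π * ((π ^ q * l ^ (-q) - 1) ^ 2 * Real.sin l) := by
  have h : ∀ φ, sphDist 0 l φ = l := fun φ => by
    simp [sphDist, Real.arccos_cos hl.1.le hl.2]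
  simp only [corrIntegrand, h, intervalIntegral.integral_const, smul_eq_mul]
  ring

lemma corrIntegrand_sub {q θ l : ℝ} (hθ : θ ∈ Icc 0 π) (hl : l ∈ Ioc 0 π) (hne : l ≠ θ) :
    corrIntegrand q 0 l - corrIntegrand q θ l = π ^ q * powerIntegrand q θ l := by
  have hc := continuous_sphDist_rpow q hθ (Ioc_subset_Icc_self hl) hne
  have h : ∫ φ in (0:ℝ)..π, (π ^ q * sphDist θ l φ ^ (-q) - 1) =
      π * (π ^ q * l ^ (-q) - 1) - π ^ q * kernelGap q θ l := by
    rw [kernelGap, intervalIntegral.integral_sub ((hc.const_mul _).intervalIntegrable _ _)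
      (by simp), intervalIntegral.integral_sub (by simp) (hc.intervalIntegrable _ _),
      intervalIntegral.integral_const_mul]
    simp only [intervalIntegral.integral_const, smul_eq_mul]
    ring
  rw [corrIntegrand_zero hl, corrIntegrand, h, powerIntegrand]
  ring

lemma integrableOn_corrIntegrand_zero {q : ℝ} (hq : q ∈ Ioo (0:ℝ) 1) :
    IntegrableOn (corrIntegrand q 0) (Ioc 0 π) := by
  have h1 : IntegrableOn (fun x : ℝ => π * (π ^ q * π ^ q * x ^ (1 - 2 * q))) (Ioc 0 π) :=
    (((intervalIntegrable_iff_integrableOn_Ioc_of_le Real.pi_pos.le).1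
      (intervalIntegral.intervalIntegrable_rpow' (by linarith [hq.2]))).const_mul _).const_mul _
  have h2 : IntegrableOn (fun l => π * ((π ^ q * l ^ (-q) - 1) ^ 2 * Real.sin l)) (Ioc 0 π) := by
    refine h1.mono' (Measurable.aestronglyMeasurable (by fun_prop)) ?_
    filter_upwards [ae_restrict_mem measurableSet_Ioc] with l hl
    have hs := Real.sin_nonneg_of_mem_Icc (Ioc_subset_Icc_self hl)
    have hk := abs_power_kernel_le hq.1.le hl
    have hπ := Real.pi_pos
    rw [Real.norm_eq_abs, abs_of_nonneg (by positivity), ← sq_abs]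
    calc _ ≤ π * ((π ^ q * l ^ (-q)) ^ 2 * l) := by
          gcongr; exact Real.sin_le hl.1.le
      _ = _ := by
          rw [show 1 - 2 * q = -q + -q + 1 by ring, Real.rpow_add_one hl.1.ne',
            Real.rpow_add hl.1]
          ring
  exact h2.congr_fun (fun l hl => (corrIntegrand_zero hl).symm) measurableSet_Ioc

lemma integral_corrIntegrand_sub {q θ : ℝ} (hq : q ∈ Ioo (0:ℝ) 1) (hθ : 0 < θ) (hθ1 : θ ≤ 1) :
    (∫ l in (0:ℝ)..π, corrIntegrand q 0 l) - ∫ l in (0:ℝ)..π, corrIntegrand q θ l =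
      π ^ q * ∫ l in (0:ℝ)..π, powerIntegrand q θ l := by
  have h0 := integrableOn_corrIntegrand_zero hq
  have hp := (integrableOn_powerIntegrand hq hθ hθ1).const_mul (π ^ q)
  have hθm : θ ∈ Icc 0 π := ⟨hθ.le, by linarith [Real.pi_gt_three]⟩
  have h : ∀ᵐ l ∂volume.restrict (Ioc 0 π),
      corrIntegrand q θ l = corrIntegrand q 0 l - π ^ q * powerIntegrand q θ l := by
    filter_upwards [ae_restrict_mem measurableSet_Ioc,
      ae_restrict_of_ae (Measure.ae_ne volume θ)] with l hl hne
    rw [← corrIntegrand_sub hθm hl hne]; ring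
  simp only [intervalIntegral.integral_of_le Real.pi_pos.le]
  rw [integral_congr_ae h, integral_sub h0 hp, integral_const_mul]
  ring

/-- For `q ∈ (0,1)`, the correlation function associated with the power kernel
`k(θ) = (θ/π)^{-q} − 1` satisfies `lim_{θ↓0} (C(0) − C(θ))/θ^{2−2q} = b_q`, where
`b_q = (2π^{2q}/c₂) ∫₀^∞ x^{1−q} ∫₀^π (x^{−q} − (x²+1−2x cos φ)^{−q/2}) dφ dx`;
in particular the correlation function has fractal index `2 − 2q`. -/
theorem power_kernel_fractal_index (q : ℝ) (hq : q ∈ Ioo (0:ℝ) 1)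
    (c₂ : ℝ) (hc₂ : c₂ = 2 * π * ∫ l in (0:ℝ)..π, (π ^ q * l ^ (-q) - 1) ^ 2 * Real.sin l)
    (C : ℝ → ℝ)
    (hC : ∀ θ : ℝ, C θ = (2 / c₂) *
      ∫ l in (0:ℝ)..π, (π ^ q * l ^ (-q) - 1) * Real.sin l *
        ∫ φ in (0:ℝ)..π,
          (π ^ q *
            (Real.arccos (Real.sin θ * Real.sin l * Real.cos φ + Real.cos θ * Real.cos l)) ^ (-q)
            - 1))
    (bq : ℝ)
    (hbq : bq = (2 * π ^ (2 * q) / c₂) *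
      ∫ x in Ioi (0:ℝ), x ^ (1 - q) *
        ∫ φ in (0:ℝ)..π, (x ^ (-q) - (x ^ 2 + 1 - 2 * x * Real.cos φ) ^ (-q / 2))) :
    Tendsto (fun θ => (C 0 - C θ) / θ ^ (2 - 2 * q)) (nhdsWithin 0 (Ioi 0)) (nhds bq) := by
  have hC' : ∀ θ, C θ = (2 / c₂) * ∫ l in (0:ℝ)..π, corrIntegrand q θ l := hC
  have h := (tendsto_integral_scaledIntegrand hq).const_mul ((2 / c₂) * π ^ q)
  have e : bq = (2 / c₂) * π ^ q * (π ^ q * ∫ x in Ioi (0:ℝ), x ^ (1 - q) *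
      ∫ φ in (0:ℝ)..π, (x ^ (-q) - (x ^ 2 + 1 - 2 * x * Real.cos φ) ^ (-q / 2))) := by
    rw [hbq, two_mul q, Real.rpow_add Real.pi_pos]
    ring
  rw [e]
  refine h.congr' ?_
  filter_upwards [Ioc_mem_nhdsGT (zero_lt_one : (0:ℝ) < 1)] with θ hθ
  rw [integral_scaledIntegrand hθ.1, hC', hC', ← mul_sub,
    integral_corrIntegrand_sub hq hθ.1 hθ.2]
  ring
end

section
/- For q ∈ (0,1), the double integral ∫₀^∞ x^{1−q} ∫₀^π (x^{−q} − (x² + 1 − 2x cos φ)^{−q/2}) dφ dx equals (π/(2(1−q)²)) · Γ(1 − q/2)² Γ(q) / (Γ(q/2)² Γ(1−q)). In particular, this integral is finite and strictly positive. -/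
open Real Set MeasureTheory

section

open Filter Topology Finset

/-- The coefficients `(a)ₙ / n!` of the power series of `(1 - z) ^ (-a)`. -/
noncomputable def binomCoeff (a : ℝ) (n : ℕ) : ℝ := ∏ j ∈ range n, (a + j) / (1 + j)

lemma binomCoeff_zero (a : ℝ) : binomCoeff a 0 = 1 := by simp [binomCoeff]

lemma binomCoeff_succ (a : ℝ) (n : ℕ) :
    binomCoeff a (n + 1) = binomCoeff a n * ((a + n) / (1 + n)) := by
  rw [binomCoeff, binomCoeff, prod_range_succ]

lemma binomCoeff_pos {a : ℝ} (ha : 0 < a) (n : ℕ) : 0 < binomCoeff a n :=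
  prod_pos fun _ _ => by positivity

lemma binomCoeff_le_rpow {a : ℝ} (ha : 0 < a) (ha1 : a < 1) (n : ℕ) :
    binomCoeff a n ≤ ((n : ℝ) + 1) ^ (a - 1) := by
  induction n with
  | zero => simp [binomCoeff_zero]
  | succ n ih =>
    have hn : (0 : ℝ) < (n : ℝ) + 1 := by positivity
    have h1 : (a + n) / (1 + n) ≤ (1 + 1 / ((n : ℝ) + 1)) ^ (a - 1) := by
      have hb : (1 + 1 / ((n : ℝ) + 1)) ^ (1 - a) ≤ 1 + (1 - a) * (1 / ((n : ℝ) + 1)) :=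
        rpow_one_add_le_one_add_mul_self (neg_one_lt_zero.le.trans (by positivity))
          (by linarith) (by linarith)
      have hp : (0 : ℝ) < (1 + 1 / ((n : ℝ) + 1)) ^ (1 - a) := by positivity
      rw [show a - 1 = -(1 - a) by ring, Real.rpow_neg (by positivity)]
      refine le_trans ?_ (inv_anti₀ hp hb)
      rw [div_le_iff₀ (by positivity), inv_mul_eq_div, le_div_iff₀
        (by have := sub_pos.2 ha1; positivity)]
      have : (1 + (1 - a) * (1 / ((n : ℝ) + 1))) = (n + 1 + (1 - a)) / (n + 1) := by
        field_simp
      rw [this, ← mul_div_assoc, div_le_iff₀ hn]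
      nlinarith [sq_nonneg (1 - a)]
    rw [binomCoeff_succ]
    calc _ ≤ ((n : ℝ) + 1) ^ (a - 1) * (1 + 1 / ((n : ℝ) + 1)) ^ (a - 1) :=
          mul_le_mul ih h1 (by positivity) (by positivity)
      _ = _ := by
          rw [← Real.mul_rpow (by positivity) (by positivity)]
          congr 1
          push_cast
          field_simp

/-- The quotient of Pochhammer symbols in the general term `wellPoisedTerm a k n`. -/
noncomputable def wellPoisedProd (a k : ℝ) (n : ℕ) : ℝ :=
  ∏ j ∈ range n, ((a + k + j) * (a + j) * (1 - a + j) * (2 * a - 1 + j)) /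
    ((1 + j) * (1 + k + j) * (2 * a + k + j) * (2 - a + k + j))

/-- The general term of the very well-poised series
`₅F₄(a + k, 1 + (a + k) / 2, a, 1 - a, 2a - 1; (a + k) / 2, 1 + k, 2a + k, 2 - a + k; 1)`. -/
noncomputable def wellPoisedTerm (a k : ℝ) (n : ℕ) : ℝ :=
  (2 * n + a + k) / (a + k) * wellPoisedProd a k n

lemma wellPoisedProd_succ (a k : ℝ) (n : ℕ) :
    wellPoisedProd a k (n + 1) = wellPoisedProd a k n *
      (((a + k + n) * (a + n) * (1 - a + n) * (2 * a - 1 + n)) /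
        ((1 + n) * (1 + k + n) * (2 * a + k + n) * (2 - a + k + n))) := by
  rw [wellPoisedProd, wellPoisedProd, prod_range_succ]

section
variable {a k : ℝ} (ha : 0 < a) (ha2 : a < 1 / 2) (hk : 0 ≤ k)
include ha ha2 hk

lemma wellPoisedProd_shift (n : ℕ) :
    wellPoisedProd a (k + 1) n = wellPoisedProd a k n *
      (((a + k + n) * (1 + k) * (2 * a + k) * (2 - a + k)) /
        ((a + k) * (1 + k + n) * (2 * a + k + n) * (2 - a + k + n))) := by
  have h2 : 0 < 2 - a + k := by linarith
  induction n with
  | zero =>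
    simp only [wellPoisedProd, Finset.range_zero, Finset.prod_empty, Nat.cast_zero, add_zero]
    field_simp
  | succ n ih =>
    have h3 : 0 < 2 - a + k + n := by positivity
    have h4 : 0 < 2 - a + (k + 1) + n := by linarith
    have h5 : 0 < 2 - a + k + (n + 1) := by linarith
    rw [wellPoisedProd_succ, ih, wellPoisedProd_succ]
    push_cast
    have e1 : a + (k + 1) + n = a + k + (n + 1) := by ring
    have e2 : 1 + (k + 1) + (n : ℝ) = 1 + k + (n + 1) := by ring
    have e3 : 2 * a + (k + 1) + n = 2 * a + k + (n + 1) := by ring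
    have e4 : 2 - a + (k + 1) + n = 2 - a + k + (n + 1) := by ring
    rw [e1, e2, e3, e4]
    field_simp

/-- The Wilf–Zeilberger relation behind Dougall's summation formula. -/
lemma wellPoisedTerm_telescope (n : ℕ) :
    wellPoisedTerm a k n - ((1 + a + k) * (a + k) * (2 - 2 * a + k)) /
        ((2 * a + k) * (2 - a + k) * (1 - a + k)) * wellPoisedTerm a (k + 1) n =
      wellPoisedProd a k n * (n * (n + 1 + 2 * k) / ((a + k) * (1 - a + k))) -
      wellPoisedProd a k (n + 1) *
        ((n + 1 : ℕ) * ((n + 1 : ℕ) + 1 + 2 * k) / ((a + k) * (1 - a + k))) := by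
  have h1 : 0 < 1 - a + k := by linarith
  have h2 : 0 < 2 - a + k := by linarith
  have h3 : 0 < 2 - a + k + n := by positivity
  have h4 : 0 < 1 + a + k := by linarith
  rw [wellPoisedTerm, wellPoisedTerm, wellPoisedProd_shift ha ha2 hk, wellPoisedProd_succ]
  push_cast
  rw [show a + (k + 1) = 1 + a + k by ring]
  field_simp
  ring

lemma abs_wellPoisedProd_le (n : ℕ) :
    |wellPoisedProd a k (n + 1)| ≤ binomCoeff a (n + 1) *
      ((1 - a) * (1 - 2 * a) / ((2 - a + n) * (2 * a + n))) * (2 * a / (2 * a + k)) := by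
  have hq : 0 < 1 - 2 * a := by linarith
  have hp : 0 < 1 - a := by linarith
  have hr : 0 < 2 - a := by linarith
  have key : ∀ m : ℕ, |((a + k + m) * (a + m) * (1 - a + m) * (2 * a - 1 + m)) /
        ((1 + m) * (1 + k + m) * (2 * a + k + m) * (2 - a + k + m))| =
      (a + m) / (1 + m) * ((a + k + m) / (1 + k + m)) * ((1 - a + m) / (2 - a + k + m)) *
        (|2 * a - 1 + m| / (2 * a + k + m)) := by
    intro m
    rw [abs_div, abs_mul, abs_mul, abs_mul, abs_of_pos (show 0 < a + k + m by positivity),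
      abs_of_pos (show 0 < a + m by positivity), abs_of_pos (show 0 < 1 - a + m by positivity),
      abs_of_pos (show 0 < (1 + m) * (1 + k + m) * (2 * a + k + m) * (2 - a + k + m) by
        positivity)]
    field_simp
  have hle : ∀ m : ℕ, (a + k + m) / (1 + k + m) ≤ 1 := fun m =>
    (div_le_one (by positivity)).2 (by linarith)
  have hle2 : ∀ m : ℕ, (1 - a + m) / (2 - a + k + m) ≤ (1 - a + m) / (2 - a + m) := fun m =>
    div_le_div_of_nonneg_left (by positivity) (by positivity) (by linarith)
  induction n with
  | zero =>
    rw [wellPoisedProd_succ, abs_mul, key, binomCoeff_succ, binomCoeff_zero]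
    simp only [wellPoisedProd, Finset.range_zero, Finset.prod_empty, abs_one, one_mul]
    calc _ ≤ (a + (0 : ℕ)) / (1 + (0 : ℕ)) * 1 * ((1 - a + (0 : ℕ)) / (2 - a + (0 : ℕ))) *
        (|2 * a - 1 + (0 : ℕ)| / (2 * a + k + (0 : ℕ))) := by
          gcongr
          · exact hle 0
          · linarith
      _ = _ := by
        simp only [Nat.cast_zero, add_zero]
        rw [abs_of_neg (by linarith)]
        field_simp
        ring
  | succ n ih =>
    rw [wellPoisedProd_succ, abs_mul, key, binomCoeff_succ a (n + 1)]
    have hn : (0 : ℝ) ≤ n := n.cast_nonneg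
    have hc := binomCoeff_pos ha (n + 1)
    calc _ ≤ (binomCoeff a (n + 1) *
      ((1 - a) * (1 - 2 * a) / ((2 - a + n) * (2 * a + n))) * (2 * a / (2 * a + k))) *
        ((a + (n + 1 : ℕ)) / (1 + (n + 1 : ℕ)) * 1 *
          ((1 - a + (n + 1 : ℕ)) / (2 - a + (n + 1 : ℕ))) *
        (|2 * a - 1 + (n + 1 : ℕ)| / (2 * a + (n + 1 : ℕ)))) := by
          gcongr
          · exact hle _
          · linarith
          · linarith
      _ = _ := by
        push_cast
        rw [abs_of_pos (by linarith)]
        have e1 : 2 * a - 1 + ((n : ℝ) + 1) = 2 * a + n := by ring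
        have e2 : 1 - a + ((n : ℝ) + 1) = 2 - a + n := by ring
        rw [e1, e2]
        have : 0 < 2 - a + (n + 1) := by linarith
        field_simp

lemma abs_wellPoisedProd_mul_sq_le (n : ℕ) :
    |wellPoisedProd a k (n + 1)| * ((n + 1 : ℕ) : ℝ) ^ 2 ≤
      ((n + 1 : ℕ) : ℝ) ^ (a - 1) / (2 * a + k) := by
  have hc := binomCoeff_le_rpow ha (by linarith) (n + 1)
  have hc0 := binomCoeff_pos ha (n + 1)
  have hn : (0 : ℝ) ≤ n := n.cast_nonneg
  have hq : 0 < 1 - 2 * a := by linarith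
  have hp : 0 < 1 - a := by linarith
  have hr : 0 < 2 - a := by linarith
  have hmono : (((n + 1 : ℕ) : ℝ) + 1) ^ (a - 1) ≤ ((n + 1 : ℕ) : ℝ) ^ (a - 1) :=
    Real.rpow_le_rpow_of_nonpos (by positivity) (by linarith) (by linarith)
  have hfrac : ((1 - a) * (1 - 2 * a) / ((2 - a + n) * (2 * a + n))) * (2 * a) *
      ((n + 1 : ℕ) : ℝ) ^ 2 ≤ 1 := by
    push_cast
    rw [div_mul_eq_mul_div, div_mul_eq_mul_div, div_le_one (by positivity)]
    have h1 : 2 * a * (n + 1) ≤ 2 * a + n := by nlinarith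
    have h2 : (n : ℝ) + 1 ≤ 2 - a + n := by linarith
    have h3 : (1 - a) * (1 - 2 * a) ≤ 1 := by nlinarith
    calc (1 - a) * (1 - 2 * a) * (2 * a) * ((n : ℝ) + 1) ^ 2
        ≤ 1 * (2 * a) * ((n : ℝ) + 1) ^ 2 := by gcongr
      _ = (n + 1) * (2 * a * (n + 1)) := by ring
      _ ≤ _ := by gcongr
  calc _ ≤ binomCoeff a (n + 1) *
      ((1 - a) * (1 - 2 * a) / ((2 - a + n) * (2 * a + n))) * (2 * a / (2 * a + k)) *
        ((n + 1 : ℕ) : ℝ) ^ 2 := by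
        gcongr
        exact abs_wellPoisedProd_le ha ha2 hk n
    _ = binomCoeff a (n + 1) * (((1 - a) * (1 - 2 * a) / ((2 - a + n) * (2 * a + n))) * (2 * a) *
        ((n + 1 : ℕ) : ℝ) ^ 2) / (2 * a + k) := by ring
    _ ≤ ((n + 1 : ℕ) : ℝ) ^ (a - 1) * 1 / (2 * a + k) := by
        gcongr
        exact hc.trans hmono
    _ = _ := by rw [mul_one]

lemma abs_wellPoisedTerm_le (n : ℕ) :
    |wellPoisedTerm a k (n + 1)| ≤
      3 / (a * (2 * a + k)) * ((n + 1 : ℕ) : ℝ) ^ (a - 2) := by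
  have h := abs_wellPoisedProd_mul_sq_le ha ha2 hk n
  have hN : (1 : ℝ) ≤ ((n + 1 : ℕ) : ℝ) := by simp
  set N : ℝ := ((n + 1 : ℕ) : ℝ)
  have h0 : 0 < N := by linarith
  have hf : (2 * N + a + k) / (a + k) ≤ 3 / a * N := by
    rw [div_mul_eq_mul_div, div_le_div_iff₀ (by positivity) ha]
    nlinarith [mul_nonneg hk h0.le, mul_nonneg hk ha.le, mul_le_mul_of_nonneg_left hN ha.le,
      mul_le_mul_of_nonneg_left hN hk, mul_pos ha h0]
  rw [wellPoisedTerm, abs_mul, abs_of_nonneg (by positivity)]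
  have e : N ^ (a - 2) = N ^ (a - 1) / N := by
    rw [show a - 2 = a - 1 - 1 by ring, Real.rpow_sub_one h0.ne']
  calc _ ≤ 3 / a * N * |wellPoisedProd a k (n + 1)| := by gcongr
    _ = 3 / a * (|wellPoisedProd a k (n + 1)| * N ^ 2) / N := by field_simp
    _ ≤ 3 / a * (N ^ (a - 1) / (2 * a + k)) / N := by gcongr
    _ = _ := by rw [e]; field_simp

lemma summable_wellPoisedTerm : Summable (wellPoisedTerm a k) := by
  rw [← summable_nat_add_iff 1]
  refine Summable.of_norm_bounded ?_ (abs_wellPoisedTerm_le ha ha2 hk)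
  refine Summable.mul_left _ ?_
  exact (summable_nat_add_iff 1).2 (Real.summable_nat_rpow.2 (by linarith))

lemma tsum_wellPoisedTerm_shift :
    ∑' n, wellPoisedTerm a k n = ((1 + a + k) * (a + k) * (2 - 2 * a + k)) /
        ((2 * a + k) * (2 - a + k) * (1 - a + k)) * ∑' n, wellPoisedTerm a (k + 1) n := by
  have s1 := summable_wellPoisedTerm ha ha2 hk
  have s2 := (summable_wellPoisedTerm ha ha2 (k := k + 1) (by linarith)).mul_left
    (((1 + a + k) * (a + k) * (2 - 2 * a + k)) / ((2 * a + k) * (2 - a + k) * (1 - a + k)))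
  rw [← tsum_mul_left, ← sub_eq_zero, ← s1.tsum_sub s2]
  refine tendsto_nhds_unique (s1.sub s2).hasSum.tendsto_sum_nat ?_
  simp_rw [wellPoisedTerm_telescope ha ha2 hk]
  have hp : 0 < 1 - a + k := by linarith
  set G : ℕ → ℝ := fun n => wellPoisedProd a k n *
    (n * (n + 1 + 2 * k) / ((a + k) * (1 - a + k))) with hG
  have hsum : ∀ N : ℕ, ∑ n ∈ range N, (G n - G (n + 1)) = - G N := by
    intro N
    rw [sum_range_sub']
    simp [hG]
  refine Tendsto.congr (fun N => (hsum N).symm) ?_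
  rw [← neg_zero]
  refine Tendsto.neg ?_
  rw [← tendsto_add_atTop_iff_nat 1]
  have hlim : Tendsto (fun n : ℕ => (2 + 2 * k) / ((2 * a + k) * ((a + k) * (1 - a + k))) *
      ((n + 1 : ℕ) : ℝ) ^ (a - 1)) atTop (𝓝 0) := by
    have h1 : Tendsto (fun x : ℝ => x ^ (-(1 - a))) atTop (𝓝 0) :=
      tendsto_rpow_neg_atTop (by linarith)
    have h2 := (h1.comp tendsto_natCast_atTop_atTop).comp (tendsto_add_atTop_nat 1)
    have := h2.const_mul ((2 + 2 * k) / ((2 * a + k) * ((a + k) * (1 - a + k))))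
    rw [mul_zero] at this
    refine this.congr fun n => ?_
    simp only [Function.comp]
    congr 2
    ring
  refine squeeze_zero_norm (fun n => ?_) hlim
  have h := abs_wellPoisedProd_mul_sq_le ha ha2 hk n
  have hN : (1 : ℝ) ≤ ((n + 1 : ℕ) : ℝ) := by simp
  simp only [hG]
  set N : ℝ := ((n + 1 : ℕ) : ℝ)
  have h0 : 0 < N := by linarith
  rw [Real.norm_eq_abs, abs_mul, abs_of_nonneg (a := N * (N + 1 + 2 * k) / _) (by positivity)]
  calc _ ≤ |wellPoisedProd a k (n + 1)| *
        (N * (N * (2 + 2 * k)) / ((a + k) * (1 - a + k))) := by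
        gcongr
        nlinarith
    _ = |wellPoisedProd a k (n + 1)| * N ^ 2 * ((2 + 2 * k) / ((a + k) * (1 - a + k))) := by ring
    _ ≤ (N ^ (a - 1) / (2 * a + k)) * ((2 + 2 * k) / ((a + k) * (1 - a + k))) := by gcongr
    _ = _ := by field_simp

end

lemma tendsto_tsum_wellPoisedTerm {a : ℝ} (ha : 0 < a) (ha2 : a < 1 / 2) :
    Tendsto (fun k : ℕ => ∑' n, wellPoisedTerm a k n) atTop (𝓝 1) := by
  have hS : Summable fun n : ℕ => ((n + 1 : ℕ) : ℝ) ^ (a - 2) :=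
    (summable_nat_add_iff 1).2 (Real.summable_nat_rpow.2 (by linarith))
  rw [tendsto_iff_norm_sub_tendsto_zero]
  have hlim : Tendsto (fun k : ℕ => 3 / (a * (2 * a + k)) * ∑' n : ℕ, ((n + 1 : ℕ) : ℝ) ^ (a - 2))
      atTop (𝓝 0) := by
    rw [← zero_mul (∑' n : ℕ, ((n + 1 : ℕ) : ℝ) ^ (a - 2))]
    refine Tendsto.mul_const _ (Tendsto.const_div_atTop ?_ _)
    exact (tendsto_atTop_add_const_left _ _ tendsto_natCast_atTop_atTop).const_mul_atTop ha
  refine squeeze_zero (fun _ => norm_nonneg _) (fun k => ?_) hlim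
  have hk : (0 : ℝ) ≤ k := k.cast_nonneg
  have h0 : wellPoisedTerm a k 0 = 1 := by
    have : a + k ≠ 0 := by positivity
    simp [wellPoisedTerm, wellPoisedProd, this]
  rw [(summable_wellPoisedTerm ha ha2 hk).tsum_eq_zero_add, h0, add_sub_cancel_left,
    ← tsum_mul_left]
  exact tsum_of_norm_bounded (hS.mul_left _).hasSum (abs_wellPoisedTerm_le ha ha2 hk)

lemma tsum_wellPoisedTerm_zero {a : ℝ} (ha : 0 < a) (ha2 : a < 1 / 2) :
    ∑' n, wellPoisedTerm a 0 n =
      Gamma (2 * a) * Gamma (2 - a) * Gamma (1 - a) /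
        (Gamma (1 + a) * Gamma a * Gamma (2 - 2 * a)) := by
  have hprod : ∀ N : ℕ, ∑' n, wellPoisedTerm a 0 n =
      (∏ k ∈ range N, ((1 + a + k) * (a + k) * (2 - 2 * a + k)) /
        ((2 * a + k) * (2 - a + k) * (1 - a + k))) * ∑' n, wellPoisedTerm a N n := by
    intro N
    induction N with
    | zero => simp
    | succ N ih =>
      rw [ih, prod_range_succ, tsum_wellPoisedTerm_shift ha ha2 N.cast_nonneg]
      push_cast
      ring
  have hG : ∀ N : ℕ, N ≠ 0 → ∏ k ∈ range (N + 1), ((1 + a + k) * (a + k) * (2 - 2 * a + k)) /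
        ((2 * a + k) * (2 - a + k) * (1 - a + k)) =
      GammaSeq (2 * a) N * GammaSeq (2 - a) N * GammaSeq (1 - a) N /
        (GammaSeq (1 + a) N * GammaSeq a N * GammaSeq (2 - 2 * a) N) := by
    intro N hN
    have hN0 : (0 : ℝ) < N := by positivity
    have hpos : ∀ s : ℝ, 0 < s → ∏ j ∈ range (N + 1), (s + j) ≠ 0 := fun s hs =>
      (prod_pos fun _ _ => by positivity).ne'
    have h1 := hpos (2 * a) (by linarith)
    have h2 := hpos (2 - a) (by linarith)
    have h3 := hpos (1 - a) (by linarith)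
    have h4 := hpos (1 + a) (by linarith)
    have h5 := hpos a ha
    have h6 := hpos (2 - 2 * a) (by linarith)
    simp only [GammaSeq, prod_div_distrib, prod_mul_distrib]
    generalize ∏ j ∈ range (N + 1), (2 - 2 * a + j) = z at *
    have e : (N : ℝ) ^ (2 * a) * (N : ℝ) ^ (2 - a) * (N : ℝ) ^ (1 - a) =
        (N : ℝ) ^ (1 + a) * (N : ℝ) ^ a * (N : ℝ) ^ (2 - 2 * a) := by
      simp only [← Real.rpow_add hN0]
      congr 1
      ring
    have f0 : (N.factorial : ℝ) ≠ 0 := by positivity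
    have g1 : (N : ℝ) ^ (1 + a) ≠ 0 := by positivity
    have g2 : (N : ℝ) ^ a ≠ 0 := by positivity
    have g3 : (N : ℝ) ^ (2 - 2 * a) ≠ 0 := by positivity
    rw [div_eq_div_iff (by positivity) (by positivity)]
    generalize (N : ℝ) ^ (2 * a) = y1 at *
    generalize (N : ℝ) ^ (2 - a) = y2 at *
    generalize (N : ℝ) ^ (1 - a) = y3 at *
    generalize (N : ℝ) ^ (1 + a) = y4 at *
    generalize (N : ℝ) ^ a = y5 at *
    generalize (N : ℝ) ^ (2 - 2 * a) = y6 at *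
    field_simp
    linear_combination -e
  have hlim : Tendsto (fun N : ℕ => GammaSeq (2 * a) N * GammaSeq (2 - a) N * GammaSeq (1 - a) N /
      (GammaSeq (1 + a) N * GammaSeq a N * GammaSeq (2 - 2 * a) N) *
        ∑' n, wellPoisedTerm a (N + 1 : ℕ) n) atTop
      (𝓝 (Gamma (2 * a) * Gamma (2 - a) * Gamma (1 - a) /
        (Gamma (1 + a) * Gamma a * Gamma (2 - 2 * a)) * 1)) := by
    have h4 := (Gamma_pos_of_pos (show 0 < 1 + a by linarith)).ne'
    have h5 := (Gamma_pos_of_pos ha).ne'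
    have h6 := (Gamma_pos_of_pos (show 0 < 2 - 2 * a by linarith)).ne'
    refine Tendsto.mul (Tendsto.div ?_ ?_ (by positivity))
      ((tendsto_add_atTop_iff_nat 1).2 (tendsto_tsum_wellPoisedTerm ha ha2))
    · exact ((GammaSeq_tendsto_Gamma _).mul (GammaSeq_tendsto_Gamma _)).mul
        (GammaSeq_tendsto_Gamma _)
    · exact ((GammaSeq_tendsto_Gamma _).mul (GammaSeq_tendsto_Gamma _)).mul
        (GammaSeq_tendsto_Gamma _)
  rw [mul_one] at hlim
  refine tendsto_nhds_unique (tendsto_const_nhds.congr' ?_) hlim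
  filter_upwards [eventually_ne_atTop 0] with N hN
  rw [← hG N hN]
  exact hprod (N + 1)

lemma wellPoisedProd_zero {a : ℝ} (ha : 0 < a) (ha2 : a < 1 / 2) (n : ℕ) :
    wellPoisedProd a 0 n =
      binomCoeff a n ^ 2 * ((1 - a) * (2 * a - 1) / ((n + 1 - a) * (n + 2 * a - 1))) := by
  have hne : ∀ n : ℕ, (n : ℝ) + 2 * a - 1 ≠ 0 := by
    rintro (_ | n)
    · simp; linarith
    · push_cast
      have : (0 : ℝ) < (n : ℝ) + 2 * a := by positivity
      intro h; linarith
  have hne' : ∀ n : ℕ, (n : ℝ) + 1 - a ≠ 0 := fun n => by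
    have hn : (0 : ℝ) ≤ n := n.cast_nonneg
    intro h; linarith
  induction n with
  | zero =>
    have h1 := hne 0
    have h2 := hne' 0
    simp only [Nat.cast_zero, zero_add] at h1 h2
    simp only [wellPoisedProd, Finset.range_zero, Finset.prod_empty, binomCoeff_zero, Nat.cast_zero,
      zero_add]
    rw [div_self (mul_ne_zero h2 h1), one_pow, one_mul]
  | succ n ih =>
    have h1 := hne n
    have h2 := hne' n
    have h3 := hne (n + 1)
    have h4 := hne' (n + 1)
    rw [wellPoisedProd_succ, ih, binomCoeff_succ]
    push_cast at *
    have e1 : 2 - a + 0 + (n : ℝ) = n + 1 + 1 - a := by ring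
    have e2 : 2 * a + 0 + (n : ℝ) = n + 1 + 2 * a - 1 := by ring
    have e3 : 1 - a + (n : ℝ) = n + 1 - a := by ring
    have e4 : 2 * a - 1 + (n : ℝ) = n + 2 * a - 1 := by ring
    have e5 : (n : ℝ) + 1 + 2 * a - 1 = n + 2 * a := by ring
    rw [e5] at h3
    rw [e1, e2, e3, e4, e5]
    simp only [add_zero]
    generalize (n : ℝ) + 2 * a - 1 = x at *
    field_simp

/-- A special case of Dougall's `₅F₄` summation formula. -/
lemma hasSum_binomCoeff_sq {a : ℝ} (ha : 0 < a) (ha2 : a < 1 / 2) :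
    HasSum (fun n : ℕ => binomCoeff a n ^ 2 *
        (1 / ((n : ℝ) + 1 - a) + 1 / ((n : ℝ) + 2 * a - 1)))
      (-(Gamma (1 - a) ^ 2 * Gamma (2 * a) /
        ((1 - 2 * a) ^ 2 * (Gamma a ^ 2 * Gamma (1 - 2 * a))))) := by
  have h := (summable_wellPoisedTerm ha ha2 le_rfl).hasSum
  rw [tsum_wellPoisedTerm_zero ha ha2] at h
  have hq : 1 - 2 * a ≠ 0 := by linarith
  have hq' : 2 * a - 1 ≠ 0 := by linarith
  have hp : 1 - a ≠ 0 := by linarith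
  convert! h.mul_left (a / ((1 - a) * (2 * a - 1))) using 1
  · ext n
    have hn : (0 : ℝ) ≤ n := n.cast_nonneg
    have h1 : (n : ℝ) + 1 - a ≠ 0 := by linarith
    have h2 : (n : ℝ) + 2 * a - 1 ≠ 0 := by
      rcases n with _ | n
      · simpa using hq'
      · push_cast
        have : (0 : ℝ) < (n : ℝ) + 2 * a := by positivity
        intro h; linarith
    rw [wellPoisedTerm, wellPoisedProd_zero ha ha2,
      show 2 * (n : ℝ) + a + 0 = (n + 1 - a) + (n + 2 * a - 1) by ring]
    generalize (n : ℝ) + 2 * a - 1 = x at *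
    generalize 2 * a - 1 = y at *
    field_simp
    ring
  · have g1 : Gamma (2 - a) = (1 - a) * Gamma (1 - a) := by
      rw [← Gamma_add_one hp]; ring_nf
    have g2 : Gamma (1 + a) = a * Gamma a := by
      rw [← Gamma_add_one ha.ne']; ring_nf
    have g3 : Gamma (2 - 2 * a) = (1 - 2 * a) * Gamma (1 - 2 * a) := by
      rw [← Gamma_add_one hq]; ring_nf
    have g4 := (Gamma_pos_of_pos (show 0 < 1 - 2 * a by linarith)).ne'
    have g5 := (Gamma_pos_of_pos ha).ne'
    rw [g1, g2, g3, show 2 * a - 1 = -(1 - 2 * a) by ring]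
    field_simp

lemma ringChoose_add_sub_one (a : ℝ) (n : ℕ) :
    Ring.choose (a + n - 1) n = binomCoeff a n := by
  have h : (n.factorial : ℝ) * Ring.choose (a + n - 1) n = n.factorial * binomCoeff a n := by
    rw [← nsmul_eq_mul, ← Ring.descPochhammer_eq_factorial_smul_choose,
      Polynomial.descPochhammer_smeval_eq_ascPochhammer, show a + n - 1 - n + 1 = a by ring,
      Polynomial.ascPochhammer_smeval_eq_eval]
    induction n with
    | zero => simp [binomCoeff]
    | succ n ih =>
      rw [ascPochhammer_succ_eval, ih, binomCoeff_succ, Nat.factorial_succ]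
      push_cast
      field_simp
      ring
  exact mul_left_cancel₀ (by positivity) h

lemma hasSum_binomCoeff (a : ℝ) {z : ℂ} (hz : ‖z‖ < 1) :
    HasSum (fun n : ℕ => (binomCoeff a n : ℂ) * z ^ n) (1 / (1 - z) ^ (a : ℂ)) := by
  have h := (Complex.one_div_one_sub_cpow_hasFPowerSeriesOnBall_zero (a : ℂ)).hasSum
    (y := z) (by simpa [enorm_eq_nnnorm] using! hz)
  simp only [FormalMultilinearSeries.ofScalars_apply_eq, smul_eq_mul, zero_add] at h
  refine h.congr_fun fun n => ?_
  rw [← ringChoose_add_sub_one, Complex.ofReal_choose]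
  push_cast
  rfl

lemma summable_binomCoeff_mul_pow {a r : ℝ} (ha : 0 < a) (ha1 : a < 1) (hr : 0 ≤ r)
    (hr1 : r < 1) : Summable fun n : ℕ => |binomCoeff a n * r ^ n| := by
  refine Summable.of_nonneg_of_le (fun _ => abs_nonneg _) (fun n => ?_)
    (summable_geometric_of_lt_one hr hr1)
  have h := binomCoeff_pos ha n
  rw [abs_of_nonneg (by positivity)]
  refine mul_le_of_le_one_left (by positivity) ((binomCoeff_le_rpow ha ha1 n).trans ?_)
  exact Real.rpow_le_one_of_one_le_of_nonpos (by simp) (by linarith)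

lemma integral_cos_int_mul (k : ℤ) :
    ∫ φ in (0 : ℝ)..π, Real.cos (k * φ) = if k = 0 then π else 0 := by
  split_ifs with h
  · simp [h]
  · have hk : (k : ℝ) ≠ 0 := by exact_mod_cast h
    rw [intervalIntegral.integral_comp_mul_left _ hk]
    simp [Real.sin_int_mul_pi]

lemma hasSum_mul_of_summable_norm {u v : ℕ → ℂ} {s t : ℂ} (hu : HasSum u s) (hv : HasSum v t)
    (hu' : Summable fun n => ‖u n‖) (hv' : Summable fun n => ‖v n‖) :
    HasSum (fun p : ℕ × ℕ => u p.1 * v p.2) (s * t) :=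
  hu.mul hv (summable_mul_of_summable_norm hu' hv')

/-- Parseval's identity for an absolutely convergent power series with real coefficients. -/
lemma hasSum_integral_norm_sq {b : ℕ → ℝ} (hb : Summable fun n => |b n|) {f : ℝ → ℂ}
    (hf : ∀ φ : ℝ, HasSum (fun n : ℕ => (b n : ℂ) * Complex.exp (φ * Complex.I) ^ n) (f φ)) :
    HasSum (fun n => π * b n ^ 2) (∫ φ in (0 : ℝ)..π, ‖f φ‖ ^ 2) := by
  have hnorm : ∀ (φ : ℝ) (n : ℕ), ‖(b n : ℂ) * Complex.exp (φ * Complex.I) ^ n‖ = |b n| := by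
    intro φ n
    simp [Complex.norm_exp_ofReal_mul_I]
  have hpair : Summable fun p : ℕ × ℕ => |b p.1| * |b p.2| :=
    hb.mul_of_nonneg hb (fun _ => abs_nonneg _) fun _ => abs_nonneg _
  have hdouble : ∀ φ : ℝ, HasSum (fun p : ℕ × ℕ =>
      b p.1 * b p.2 * Real.cos (((p.1 : ℤ) - (p.2 : ℤ) : ℤ) * φ)) (‖f φ‖ ^ 2) := by
    intro φ
    have hnorm' : ∀ n : ℕ, ‖(b n : ℂ) * Complex.exp (-(φ * Complex.I)) ^ n‖ = |b n| := by
      intro n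
      rw [← neg_mul, ← Complex.ofReal_neg, hnorm]
    have hc : HasSum (fun n : ℕ => (b n : ℂ) * Complex.exp (-(φ * Complex.I)) ^ n)
        ((starRingEnd ℂ) (f φ)) := by
      convert! (hf φ).map (starRingEnd ℂ) Complex.continuous_conj using 1
      ext n
      simp [← Complex.exp_conj]
    have hs : Summable fun n => ‖(b n : ℂ) * Complex.exp (φ * Complex.I) ^ n‖ := by
      simpa only [hnorm] using hb
    have hs' : Summable fun n => ‖(b n : ℂ) * Complex.exp (-(φ * Complex.I)) ^ n‖ := by
      simpa only [hnorm'] using hb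
    have hre := Complex.hasSum_re (hasSum_mul_of_summable_norm (hf φ) hc hs hs')
    rw [Complex.mul_conj, Complex.normSq_eq_norm_sq, Complex.ofReal_re] at hre
    convert! hre using 1
    ext p
    have e : Complex.exp (φ * Complex.I) ^ p.1 * Complex.exp (-(φ * Complex.I)) ^ p.2 =
        Complex.exp (((((p.1 : ℤ) - (p.2 : ℤ) : ℤ) * φ : ℝ) : ℂ) * Complex.I) := by
      rw [← Complex.exp_nat_mul, ← Complex.exp_nat_mul, ← Complex.exp_add]
      congr 1
      push_cast
      ring
    rw [mul_mul_mul_comm, e, ← Complex.ofReal_mul, Complex.re_ofReal_mul,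
      Complex.exp_ofReal_mul_I_re]
  have hInt := intervalIntegral.hasSum_integral_of_dominated_convergence
    (μ := volume) (a := 0) (b := π)
    (F := fun (p : ℕ × ℕ) (φ : ℝ) =>
      b p.1 * b p.2 * Real.cos (((p.1 : ℤ) - (p.2 : ℤ) : ℤ) * φ))
    (f := fun φ => ‖f φ‖ ^ 2) (fun p _ => |b p.1| * |b p.2|)
    (fun p => Continuous.aestronglyMeasurable (by fun_prop))
    (fun p => Eventually.of_forall fun φ _ => by
      rw [Real.norm_eq_abs, abs_mul, abs_mul]
      exact mul_le_of_le_one_right (by positivity) (Real.abs_cos_le_one _))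
    (Eventually.of_forall fun _ _ => hpair)
    (by simp)
    (Eventually.of_forall fun φ _ => hdouble φ)
  simp only [intervalIntegral.integral_const_mul, integral_cos_int_mul] at hInt
  have hinj : Function.Injective fun n : ℕ => (n, n) := fun m n h => (Prod.mk.inj h).1
  rw [← hinj.hasSum_iff] at hInt
  · refine hInt.congr_fun fun n => ?_
    simp
    ring
  · rintro ⟨m, n⟩ hmn
    have : m ≠ n := by
      rintro rfl
      exact hmn ⟨m, rfl⟩
    simp [sub_eq_zero, this]

/-- The squared distance of `x * exp (φ * I)` from `1` is positive unless `x = 1`. -/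
lemma sq_add_one_sub_pos {x : ℝ} (hx : 0 < x) (hx1 : x ≠ 1) (φ : ℝ) :
    0 < x ^ 2 + 1 - 2 * x * Real.cos φ := by
  have := sq_pos_of_ne_zero (sub_ne_zero.2 hx1)
  nlinarith [mul_le_mul_of_nonneg_left (Real.cos_le_one φ) hx.le]

lemma hasSum_integral_kernel_of_lt_one {a x : ℝ} (ha : 0 < a) (ha1 : a < 1) (hx : 0 < x)
    (hx1 : x < 1) :
    HasSum (fun n : ℕ => π * binomCoeff a n ^ 2 * x ^ (2 * n))
      (∫ φ in (0 : ℝ)..π, (x ^ 2 + 1 - 2 * x * Real.cos φ) ^ (-a)) := by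
  have hn : ∀ φ : ℝ, ‖(x : ℂ) * Complex.exp (φ * Complex.I)‖ < 1 := fun φ => by
    simpa [Complex.norm_exp_ofReal_mul_I, abs_of_pos hx] using hx1
  have h := hasSum_integral_norm_sq (summable_binomCoeff_mul_pow ha ha1 hx.le hx1)
    (f := fun φ => 1 / (1 - x * Complex.exp (φ * Complex.I)) ^ (a : ℂ)) fun φ => by
      refine (hasSum_binomCoeff a (hn φ)).congr_fun fun n => ?_
      push_cast
      ring
  convert! h using 1
  · ext n
    ring
  · refine intervalIntegral.integral_congr fun φ _ => ?_
    have e : ‖1 - (x : ℂ) * Complex.exp (φ * Complex.I)‖ ^ 2 =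
        x ^ 2 + 1 - 2 * x * Real.cos φ := by
      rw [← Complex.normSq_eq_norm_sq, Complex.normSq_apply]
      simp [Complex.exp_ofReal_mul_I_re, Complex.exp_ofReal_mul_I_im]
      linear_combination x ^ 2 * Real.sin_sq_add_cos_sq φ
    rw [norm_div, norm_one, Complex.norm_cpow_real, ← e, one_div, inv_pow,
      ← Real.rpow_natCast, ← Real.rpow_natCast, ← Real.rpow_mul (norm_nonneg _),
      ← Real.rpow_mul (norm_nonneg _), ← Real.rpow_neg (norm_nonneg _)]
    congr 1
    push_cast
    ring

lemma integral_kernel_inv {a x : ℝ} (hx : 0 < x) (hx1 : x ≠ 1) :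
    ∫ φ in (0 : ℝ)..π, (x ^ 2 + 1 - 2 * x * Real.cos φ) ^ (-a) =
      x ^ (-2 * a) * ∫ φ in (0 : ℝ)..π, (x⁻¹ ^ 2 + 1 - 2 * x⁻¹ * Real.cos φ) ^ (-a) := by
  rw [← intervalIntegral.integral_const_mul]
  refine intervalIntegral.integral_congr fun φ _ => ?_
  have h := sq_add_one_sub_pos (inv_pos.2 hx) (inv_ne_one.2 hx1) φ
  rw [show -2 * a = ((2 : ℕ) : ℝ) * (-a) by push_cast; ring, Real.rpow_mul hx.le,
    Real.rpow_natCast, ← Real.mul_rpow (by positivity) h.le]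
  congr 1
  field_simp
  ring

lemma integral_rpow_sub_kernel {a p x : ℝ} (hx : 0 < x) (hx1 : x ≠ 1) :
    ∫ φ in (0 : ℝ)..π, (x ^ p - (x ^ 2 + 1 - 2 * x * Real.cos φ) ^ (-a)) =
      π * x ^ p - ∫ φ in (0 : ℝ)..π, (x ^ 2 + 1 - 2 * x * Real.cos φ) ^ (-a) := by
  rw [intervalIntegral.integral_sub (by simp)]
  · simp
  · refine Continuous.intervalIntegrable ?_ _ _
    exact Continuous.rpow_const (by fun_prop) fun φ => Or.inl (sq_add_one_sub_pos hx hx1 φ).ne'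

lemma integrableOn_tsum_of_nonneg {ι α : Type*} [Countable ι] [Nonempty ι] [MeasurableSpace α]
    {μ : Measure α} {s : Set α} (hs : MeasurableSet s) {F : ι → α → ℝ}
    (hF : ∀ i, IntegrableOn (F i) s μ) (hF0 : ∀ i, ∀ x ∈ s, 0 ≤ F i x)
    (hpos : ∀ i, 0 < ∫ x in s, F i x ∂μ) (hsum : Summable fun i => ∫ x in s, F i x ∂μ) :
    IntegrableOn (fun x => ∑' i, F i x) s μ ∧
      ∫ x in s, ∑' i, F i x ∂μ = ∑' i, ∫ x in s, F i x ∂μ := by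
  have hn : ∀ i, ∫ x in s, ‖F i x‖ ∂μ = ∫ x in s, F i x ∂μ := fun i =>
    setIntegral_congr_fun hs fun x hx => Real.norm_of_nonneg (hF0 i x hx)
  have h := (hasSum_integral_of_summable_integral_norm hF (by simpa only [hn] using hsum)).tsum_eq
  refine ⟨Integrable.of_integral_ne_zero ?_, h.symm⟩
  rw [← h]
  exact (hsum.tsum_pos (fun i => (hpos i).le) (Classical.arbitrary ι) (hpos _)).ne'

lemma integral_Ioo_rpow {p : ℝ} (hp : -1 < p) :
    IntegrableOn (fun x : ℝ => x ^ p) (Ioo 0 1) ∧ ∫ x in Ioo (0 : ℝ) 1, x ^ p = 1 / (p + 1) := by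
  constructor
  · exact (intervalIntegral.integrableOn_Ioo_rpow_iff one_pos).2 hp
  · rw [← integral_Ioc_eq_integral_Ioo, ← intervalIntegral.integral_of_le zero_le_one,
      integral_rpow (Or.inl hp), one_rpow, Real.zero_rpow (by linarith), sub_zero]

lemma integral_Ioi_one_rpow {p : ℝ} (hp : p < -1) :
    IntegrableOn (fun x : ℝ => x ^ p) (Ioi 1) ∧ ∫ x in Ioi (1 : ℝ), x ^ p = 1 / (-p - 1) := by
  refine ⟨integrableOn_Ioi_rpow_of_lt hp one_pos, ?_⟩
  rw [integral_Ioi_rpow_of_lt hp one_pos, one_rpow, ← neg_div_neg_eq]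
  congr 1
  · ring
  · ring

lemma integral_kernel_Ioo {q : ℝ} (hq : q ∈ Ioo (0 : ℝ) 1)
    (hs : Summable fun n : ℕ => π * binomCoeff (q / 2) n ^ 2 * (1 / (2 * n + 2 - q))) :
    IntegrableOn (fun x => x ^ (1 - q) *
        ∫ φ in (0 : ℝ)..π, (x ^ (-q) - (x ^ 2 + 1 - 2 * x * Real.cos φ) ^ (-q / 2))) (Ioo 0 1) ∧
    ∫ x in Ioo (0 : ℝ) 1, x ^ (1 - q) *
        ∫ φ in (0 : ℝ)..π, (x ^ (-q) - (x ^ 2 + 1 - 2 * x * Real.cos φ) ^ (-q / 2)) =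
      π * (1 / (2 - 2 * q)) - ∑' n : ℕ, π * binomCoeff (q / 2) n ^ 2 * (1 / (2 * n + 2 - q)) := by
  obtain ⟨hq0, hq1⟩ := hq
  have ha : 0 < q / 2 := by linarith
  set F : ℕ → ℝ → ℝ := fun n x => π * binomCoeff (q / 2) n ^ 2 * x ^ (2 * n + 1 - q) with hF
  have hmain : EqOn (fun x => x ^ (1 - q) *
      ∫ φ in (0 : ℝ)..π, (x ^ (-q) - (x ^ 2 + 1 - 2 * x * Real.cos φ) ^ (-q / 2)))
      (fun x => π * x ^ (1 - 2 * q) - ∑' n, F n x) (Ioo 0 1) := by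
    rintro x ⟨hx0, hx1⟩
    simp only
    rw [neg_div, integral_rpow_sub_kernel hx0 hx1.ne,
      ← (hasSum_integral_kernel_of_lt_one ha (by linarith) hx0 hx1).tsum_eq, mul_sub,
      ← tsum_mul_left]
    congr 1
    · rw [show 1 - 2 * q = (1 - q) + -q by ring, Real.rpow_add hx0]
      ring
    · refine tsum_congr fun n => ?_
      simp only [hF]
      rw [show 2 * (n : ℝ) + 1 - q = (1 - q) + ((2 * n : ℕ) : ℝ) by push_cast; ring,
        Real.rpow_add hx0, Real.rpow_natCast]
      ring
  have hp : ∀ n : ℕ, -1 < 2 * (n : ℝ) + 1 - q := fun n => by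
    have : (0 : ℝ) ≤ n := n.cast_nonneg
    linarith
  have hFint : ∀ n, ∫ x in Ioo (0 : ℝ) 1, F n x =
      π * binomCoeff (q / 2) n ^ 2 * (1 / (2 * n + 2 - q)) := fun n => by
    simp only [hF]
    rw [integral_const_mul, (integral_Ioo_rpow (hp n)).2]
    ring
  have hpos : ∀ n : ℕ, 0 < π * binomCoeff (q / 2) n ^ 2 * (1 / (2 * n + 2 - q)) := fun n => by
    have h1 := binomCoeff_pos ha n
    have h2 : 0 < 2 * (n : ℝ) + 2 - q := by linarith [hp n]
    positivity
  obtain ⟨hI, hE⟩ := integrableOn_tsum_of_nonneg measurableSet_Ioo (F := F)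
    (fun n => (integral_Ioo_rpow (hp n)).1.const_mul _)
    (fun n x hx => by
      have h1 := binomCoeff_pos ha n
      have h2 := hx.1
      simp only [hF]
      positivity)
    (fun n => by rw [hFint]; exact hpos n) (by simpa only [hFint] using hs)
  obtain ⟨hI', hE'⟩ := integral_Ioo_rpow (show -1 < 1 - 2 * q by linarith)
  refine ⟨(integrableOn_congr_fun hmain measurableSet_Ioo).2 ((hI'.const_mul π).sub hI), ?_⟩
  rw [setIntegral_congr_fun measurableSet_Ioo hmain, integral_sub (hI'.const_mul π) hI, hE,
    integral_const_mul, hE']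
  simp only [hFint]
  ring_nf

lemma integral_kernel_Ioi {q : ℝ} (hq : q ∈ Ioo (0 : ℝ) 1)
    (hs : Summable fun n : ℕ => π * binomCoeff (q / 2) (n + 1) ^ 2 * (1 / (2 * n + 2 * q))) :
    IntegrableOn (fun x => x ^ (1 - q) *
        ∫ φ in (0 : ℝ)..π, (x ^ (-q) - (x ^ 2 + 1 - 2 * x * Real.cos φ) ^ (-q / 2))) (Ioi 1) ∧
    ∫ x in Ioi (1 : ℝ), x ^ (1 - q) *
        ∫ φ in (0 : ℝ)..π, (x ^ (-q) - (x ^ 2 + 1 - 2 * x * Real.cos φ) ^ (-q / 2)) =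
      -∑' n : ℕ, π * binomCoeff (q / 2) (n + 1) ^ 2 * (1 / (2 * n + 2 * q)) := by
  obtain ⟨hq0, hq1⟩ := hq
  have ha : 0 < q / 2 := by linarith
  set F : ℕ → ℝ → ℝ := fun n x =>
    π * binomCoeff (q / 2) (n + 1) ^ 2 * x ^ (-(2 * n + 2 * q) - 1) with hF
  have hmain : EqOn (fun x => x ^ (1 - q) *
      ∫ φ in (0 : ℝ)..π, (x ^ (-q) - (x ^ 2 + 1 - 2 * x * Real.cos φ) ^ (-q / 2)))
      (fun x => -∑' n, F n x) (Ioi 1) := by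
    intro x hx
    have hx1 : 1 < x := hx
    have hx0 : 0 < x := one_pos.trans hx1
    have hS := hasSum_integral_kernel_of_lt_one ha (by linarith) (inv_pos.2 hx0)
      (inv_lt_one_of_one_lt₀ hx1)
    simp only
    rw [neg_div, integral_rpow_sub_kernel hx0 hx1.ne', integral_kernel_inv hx0 hx1.ne',
      ← hS.tsum_eq, hS.summable.tsum_eq_zero_add, binomCoeff_zero,
      show -2 * (q / 2) = -q by ring]
    have e : ∀ n : ℕ, F n x = x ^ (1 - q) * (x ^ (-q) *
        (π * binomCoeff (q / 2) (n + 1) ^ 2 * x⁻¹ ^ (2 * (n + 1)))) := fun n => by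
      simp only [hF]
      rw [show -(2 * (n : ℝ) + 2 * q) - 1 = (1 - q) + (-q + -((2 * (n + 1) : ℕ) : ℝ)) by
        push_cast; ring, Real.rpow_add hx0, Real.rpow_add hx0, Real.rpow_neg hx0.le,
        Real.rpow_neg hx0.le, Real.rpow_natCast, inv_pow]
      ring
    simp only [e, tsum_mul_left]
    ring
  have hp : ∀ n : ℕ, -(2 * (n : ℝ) + 2 * q) - 1 < -1 := fun n => by
    have : (0 : ℝ) ≤ n := n.cast_nonneg
    linarith
  have hFint : ∀ n, ∫ x in Ioi (1 : ℝ), F n x =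
      π * binomCoeff (q / 2) (n + 1) ^ 2 * (1 / (2 * n + 2 * q)) := fun n => by
    simp only [hF]
    rw [integral_const_mul, (integral_Ioi_one_rpow (hp n)).2]
    ring
  have hpos : ∀ n : ℕ, 0 < π * binomCoeff (q / 2) (n + 1) ^ 2 * (1 / (2 * n + 2 * q)) :=
    fun n => by
      have h1 := binomCoeff_pos ha (n + 1)
      positivity
  obtain ⟨hI, hE⟩ := integrableOn_tsum_of_nonneg measurableSet_Ioi (F := F)
    (fun n => (integral_Ioi_one_rpow (hp n)).1.const_mul _)
    (fun n x hx => by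
      have h1 := binomCoeff_pos ha (n + 1)
      have h2 : 0 < x := one_pos.trans hx
      simp only [hF]
      positivity)
    (fun n => by rw [hFint]; exact hpos n) (by simpa only [hFint] using hs)
  refine ⟨(integrableOn_congr_fun hmain measurableSet_Ioi).2 hI.neg, ?_⟩
  rw [setIntegral_congr_fun measurableSet_Ioi hmain, integral_neg, hE]
  simp only [hFint]

end

/-- For `q ∈ (0,1)`,
`∫₀^∞ x^{1−q} ∫₀^π (x^{−q} − (x²+1−2x cos φ)^{−q/2}) dφ dx
  = (π/(2(1−q)²)) Γ(1−q/2)² Γ(q) / (Γ(q/2)² Γ(1−q))`;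
in particular the double integral is finite (the integrand is integrable on
`(0,∞)`) and strictly positive. -/
theorem power_kernel_bq_explicit (q : ℝ) (hq : q ∈ Ioo (0:ℝ) 1) :
    (∫ x in Ioi (0:ℝ), x ^ (1 - q) *
        ∫ φ in (0:ℝ)..π, (x ^ (-q) - (x ^ 2 + 1 - 2 * x * Real.cos φ) ^ (-q / 2)))
      = (π / (2 * (1 - q) ^ 2)) *
          (Real.Gamma (1 - q / 2) ^ 2 * Real.Gamma q /
            (Real.Gamma (q / 2) ^ 2 * Real.Gamma (1 - q))) ∧
    IntegrableOn
      (fun x => x ^ (1 - q) *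
        ∫ φ in (0:ℝ)..π, (x ^ (-q) - (x ^ 2 + 1 - 2 * x * Real.cos φ) ^ (-q / 2)))
      (Ioi (0:ℝ)) ∧
    0 < ∫ x in Ioi (0:ℝ), x ^ (1 - q) *
        ∫ φ in (0:ℝ)..π, (x ^ (-q) - (x ^ 2 + 1 - 2 * x * Real.cos φ) ^ (-q / 2)) := by
  obtain ⟨hq0, hq1⟩ := id hq
  have ha : 0 < q / 2 := by linarith
  have hsum := hasSum_binomCoeff_sq ha (by linarith)
  have h1 : ∀ n : ℕ, 0 < (n : ℝ) + 1 - q / 2 := fun n => by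
    have : (0 : ℝ) ≤ n := n.cast_nonneg
    linarith
  set A : ℕ → ℝ := fun n => π * binomCoeff (q / 2) n ^ 2 * (1 / (2 * n + 2 - q)) with hA
  set B : ℕ → ℝ := fun n => π * binomCoeff (q / 2) (n + 1) ^ 2 * (1 / (2 * n + 2 * q)) with hB
  set G : ℕ → ℝ := fun n => π / 2 * (binomCoeff (q / 2) n ^ 2 *
    (1 / ((n : ℝ) + 1 - q / 2) + 1 / ((n : ℝ) + 2 * (q / 2) - 1))) with hG
  have hA0 : ∀ n, 0 ≤ A n := fun n => by
    have : 0 < 2 * (n : ℝ) + 2 - q := by linarith [h1 n]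
    simp only [hA]
    positivity
  have hB0 : ∀ n, 0 ≤ B n := fun n => by
    simp only [hB]
    positivity
  have hGA : ∀ n : ℕ, π * binomCoeff (q / 2) n ^ 2 * (1 / (2 * n + 2 - q)) =
      π / 2 * (binomCoeff (q / 2) n ^ 2 * (1 / ((n : ℝ) + 1 - q / 2))) := fun n => by
    rw [show 2 * (n : ℝ) + 2 - q = 2 * ((n : ℝ) + 1 - q / 2) by ring, one_div, one_div, mul_inv]
    ring
  have hG0 : G 0 = A 0 + π / (2 * q - 2) := by
    simp only [hG, hA, hGA, binomCoeff_zero]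
    rw [show 2 * q - 2 = 2 * (((0 : ℕ) : ℝ) + 2 * (q / 2) - 1) by push_cast; ring, ← div_div]
    ring
  have hGs : ∀ n, G (n + 1) = A (n + 1) + B n := fun n => by
    simp only [hG, hA, hB, hGA]
    rw [show 2 * (n : ℝ) + 2 * q = 2 * (((n + 1 : ℕ) : ℝ) + 2 * (q / 2) - 1) by push_cast; ring,
      one_div (2 * _), mul_inv]
    ring
  have hGsum : HasSum G _ := hsum.mul_left (π / 2)
  have hGsum' : Summable fun n => G (n + 1) := (summable_nat_add_iff 1).2 hGsum.summable
  have hAs : Summable A := (summable_nat_add_iff 1).1 <| hGsum'.of_nonneg_of_le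
    (fun n => hA0 _) fun n => by linarith [hGs n, hB0 n]
  have hBs : Summable B := hGsum'.of_nonneg_of_le hB0 fun n => by linarith [hGs n, hA0 (n + 1)]
  have hS := hGsum.tsum_eq
  rw [hGsum.summable.tsum_eq_zero_add] at hS
  simp only [hGs] at hS
  rw [((summable_nat_add_iff 1).2 hAs).tsum_add hBs, hG0] at hS
  have hA1 := hAs.tsum_eq_zero_add
  obtain ⟨hI1, hE1⟩ := integral_kernel_Ioo hq hAs
  obtain ⟨hI2, hE2⟩ := integral_kernel_Ioi hq hBs
  have hI1' := (integrableOn_Ioc_iff_integrableOn_Ioo).2 hI1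
  have hInt : IntegrableOn
      (fun x => x ^ (1 - q) *
        ∫ φ in (0:ℝ)..π, (x ^ (-q) - (x ^ 2 + 1 - 2 * x * Real.cos φ) ^ (-q / 2)))
      (Ioi (0:ℝ)) := by
    rw [← Ioc_union_Ioi_eq_Ioi zero_le_one]
    exact hI1'.union hI2
  have hval : (∫ x in Ioi (0:ℝ), x ^ (1 - q) *
        ∫ φ in (0:ℝ)..π, (x ^ (-q) - (x ^ 2 + 1 - 2 * x * Real.cos φ) ^ (-q / 2)))
      = (π / (2 * (1 - q) ^ 2)) *
          (Real.Gamma (1 - q / 2) ^ 2 * Real.Gamma q /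
            (Real.Gamma (q / 2) ^ 2 * Real.Gamma (1 - q))) := by
    rw [← Ioc_union_Ioi_eq_Ioi zero_le_one, setIntegral_union (Ioc_disjoint_Ioi le_rfl)
      measurableSet_Ioi hI1' hI2, integral_Ioc_eq_integral_Ioo, hE1, hE2]
    rw [show 2 * (q / 2) = q by ring] at hS
    have e1 : π / (2 * q - 2) = -(π * (1 / (2 - 2 * q))) := by
      rw [← neg_sub, div_neg, mul_one_div]
    have e2 : ∀ g h : ℝ, π / (2 * (1 - q) ^ 2) * (g / h) = -(π / 2 * -(g / ((1 - q) ^ 2 * h))) :=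
      fun g h => by
        rw [← div_div, mul_comm ((1 - q) ^ 2) h, ← div_div g]
        ring
    rw [e2, ← hS, e1]
    linarith
  refine ⟨hval, hInt, ?_⟩
  rw [hval]
  have g1 := Gamma_pos_of_pos (show 0 < 1 - q / 2 by linarith)
  have g2 := Gamma_pos_of_pos hq0
  have g3 := Gamma_pos_of_pos ha
  have g4 := Gamma_pos_of_pos (show 0 < 1 - q by linarith)
  have g5 : 0 < 1 - q := by linarith
  positivity
end
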